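/- There exist a constant c > 0 and N ∈ ℕ such that for every n ≥ N there are two symmetric generating sets S_n and S_n' of the symmetric group Sym(n), each consisting only of transpositions, satisfying S_n ⊂ S_n' ⊆ S_n³ (where S³ := {s₁s₂s₃ : s₁,s₂,s₃ ∈ S}), |S_n'| − |S_n| ≤ √|S_n|, and mix(Cay(Sym(n),S_n')) ≥ c · mix(Cay(Sym(n),S_n)) · log log log (n!). In particular, adding to S_n a set of at most √|S_n| extra generators, each a product of three generators from S_n, increases the total variation mixing time by a factor of order log log log |Sym(n)|. -/

import Mathlib

open Finset Pointwise

/-- A symmetric generating set of a group: does not contain the identity, is closed under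
inverses, and generates the group. -/
def IsSymmGen {G : Type*} [Group G] (S : Finset G) : Prop :=
  (1 : G) ∉ S ∧ (∀ s ∈ S, s⁻¹ ∈ S) ∧ Subgroup.closure (S : Set G) = ⊤

/-- Transition matrix of the lazy simple random walk on the Cayley graph `Cay(G,S)`:
`P(g,g) = 1/2` and `P(g,gs) = 1/(2|S|)` for `s ∈ S`. -/
noncomputable def lazyCayleyP {G : Type*} [Group G] [Fintype G] [DecidableEq G]
    (S : Finset G) : Matrix G G ℝ :=
  fun g h => if h = g then 1 / 2 else if g⁻¹ * h ∈ S then 1 / (2 * (S.card : ℝ)) else 0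

/-- Total variation mixing time of a discrete-time chain with transition matrix `P` whose
stationary distribution is uniform. -/
noncomputable def tvMixUnif {G : Type*} [Fintype G] [DecidableEq G] (P : Matrix G G ℝ) : ℕ :=
  sInf {t : ℕ | ∀ x : G, (∑ y : G, |(P ^ t) x y - 1 / (Fintype.card G : ℝ)|) / 2 ≤ 1 / 4}


set_option linter.unusedSectionVars false

section abstractPart
open Equiv

variable {α : Type*} [Fintype α] [DecidableEq α]

/-- permutations supported in `B` -/
def symOn (B : Finset α) : Finset (Perm α) := univ.filter (fun g => ∀ x, x ∉ B → g x = x)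

lemma mem_symOn {B : Finset α} {g : Perm α} : g ∈ symOn B ↔ ∀ x, x ∉ B → g x = x := by
  simp [symOn]

lemma symOn_one (B : Finset α) : (1 : Perm α) ∈ symOn B := by simp [mem_symOn]

lemma symOn_mul {B : Finset α} {g h : Perm α} (hg : g ∈ symOn B) (hh : h ∈ symOn B) :
    g * h ∈ symOn B := by
  rw [mem_symOn] at *
  intro x hx
  rw [Perm.mul_apply, hh x hx, hg x hx]

lemma symOn_inv {B : Finset α} {g : Perm α} (hg : g ∈ symOn B) : g⁻¹ ∈ symOn B := by
  rw [mem_symOn] at *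
  intro x hx
  rw [Perm.inv_eq_iff_eq, hg x hx]

lemma symOn_swap {B : Finset α} {a b : α} (ha : a ∈ B) (hb : b ∈ B) : swap a b ∈ symOn B := by
  rw [mem_symOn]
  intro x hx
  apply swap_apply_of_ne_of_ne
  · rintro rfl; exact hx ha
  · rintro rfl; exact hx hb

lemma symOn_mono {B C : Finset α} (h : B ⊆ C) : symOn B ⊆ symOn C := by
  intro g hg
  rw [mem_symOn] at *
  exact fun x hx => hg x (fun hB => hx (h hB))

lemma symOn_card_pos (B : Finset α) : 0 < ((symOn B).card : ℝ) := by
  exact_mod_cast Finset.card_pos.2 ⟨1, symOn_one B⟩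

lemma symOn_empty : symOn (∅ : Finset α) = {1} := by
  ext g
  simp only [mem_symOn, Finset.mem_singleton, Finset.notMem_empty, not_false_eq_true, true_imp_iff]
  constructor
  · intro h; ext x; simp [h x]
  · rintro rfl; simp

lemma symOn_insert_eq {B : Finset α} {r : α} (_hr : r ∉ B) :
    symOn (insert r B) = (symOn B ×ˢ insert r B).image (fun p => p.1 * swap p.2 r) := by
  ext h
  simp only [Finset.mem_image, Finset.mem_product, Prod.exists]
  constructor
  · intro hh
    refine ⟨h * swap (h⁻¹ r) r, h⁻¹ r, ⟨?_, ?_⟩, ?_⟩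
    · have hj : h⁻¹ r ∈ insert r B := by
        by_contra hc
        have := mem_symOn.1 hh _ hc
        rw [show h (h⁻¹ r) = r by simp] at this
        exact hc (this ▸ Finset.mem_insert_self _ _)
      have h1 : h * swap (h⁻¹ r) r ∈ symOn (insert r B) :=
        symOn_mul hh (symOn_swap hj (Finset.mem_insert_self _ _))
      rw [mem_symOn] at h1 ⊢
      intro x hx
      by_cases hxr : x = r
      · subst hxr; simp
      · exact h1 x (by simp [hxr, hx])
    · by_contra hc
      have := mem_symOn.1 hh _ hc
      rw [show h (h⁻¹ r) = r by simp] at this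
      exact hc (this ▸ Finset.mem_insert_self _ _)
    · rw [mul_assoc, swap_mul_self, mul_one]
  · rintro ⟨g, j, ⟨hg, hj⟩, rfl⟩
    exact symOn_mul (symOn_mono (Finset.subset_insert _ _) hg)
      (symOn_swap hj (Finset.mem_insert_self _ _))

lemma symOn_insert_inj {B : Finset α} {r : α} (hr : r ∉ B) :
    Set.InjOn (fun p : Perm α × α => p.1 * swap p.2 r) (symOn B ×ˢ insert r B : Finset _) := by
  rintro ⟨g, j⟩ h1 ⟨g', j'⟩ h2 h
  simp only [Finset.coe_product, Set.mem_prod, Finset.mem_coe] at h1 h2 h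
  have e1 : (g * swap j r) j = r := by simp [mem_symOn.1 h1.1 r hr]
  have e2 : (g' * swap j' r) j' = r := by simp [mem_symOn.1 h2.1 r hr]
  have : j = j' := by
    rw [← h] at e2
    exact (g * swap j r).injective (e1.trans e2.symm)
  subst this
  simpa using h

variable {A : Type*} [NormedRing A] [NormedAlgebra ℝ A] (R : Perm α →* A)

/-- average over the permutations supported in `B` -/
noncomputable def avg (B : Finset α) : A := ((symOn B).card : ℝ)⁻¹ • ∑ g ∈ symOn B, R g

lemma avg_norm (hR : ∀ g, ‖R g‖ ≤ 1) (B : Finset α) : ‖avg R B‖ ≤ 1 := by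
  unfold avg
  rw [norm_smul, Real.norm_eq_abs, abs_of_pos (inv_pos.2 (symOn_card_pos B)),
    inv_mul_le_iff₀ (symOn_card_pos B), mul_one]
  calc ‖∑ g ∈ symOn B, R g‖ ≤ ∑ g ∈ symOn B, ‖R g‖ := norm_sum_le _ _
    _ ≤ ∑ g ∈ symOn B, 1 := Finset.sum_le_sum (fun g _ => hR g)
    _ = _ := by simp

lemma avg_empty : avg R (∅ : Finset α) = 1 := by
  simp [avg, symOn_empty]

lemma avg_mul {B : Finset α} {h : Perm α} (hh : h ∈ symOn B) : avg R B * R h = avg R B := by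
  unfold avg
  rw [smul_mul_assoc, Finset.sum_mul]
  congr 1
  refine Finset.sum_bij' (fun g _ => g * h) (fun g _ => g * h⁻¹) ?_ ?_ ?_ ?_ ?_
  · intro g hg; exact symOn_mul hg hh
  · intro g hg; exact symOn_mul hg (symOn_inv hh)
  · intro g hg; simp
  · intro g hg; simp
  · intro g hg; simp

lemma mul_avg {B : Finset α} {h : Perm α} (hh : h ∈ symOn B) : R h * avg R B = avg R B := by
  unfold avg
  rw [mul_smul_comm, Finset.mul_sum]
  congr 1
  refine Finset.sum_bij' (fun g _ => h * g) (fun g _ => h⁻¹ * g) ?_ ?_ ?_ ?_ ?_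
  · intro g hg; exact symOn_mul hh hg
  · intro g hg; exact symOn_mul (symOn_inv hh) hg
  · intro g hg; simp
  · intro g hg; simp
  · intro g hg; simp

lemma avg_insert {B : Finset α} {r : α} (hr : r ∉ B) :
    avg R B * (1 + ∑ j ∈ B, R (swap j r)) = ((B.card : ℝ) + 1) • avg R (insert r B) := by
  have h1 : (1 : A) + ∑ j ∈ B, R (swap j r) = ∑ j ∈ insert r B, R (swap j r) := by
    rw [Finset.sum_insert hr]
    congr 1
    rw [swap_self]
    exact (map_one R).symm
  have hc : ((symOn (insert r B)).card : ℝ) = (symOn B).card * (B.card + 1) := by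
    rw [symOn_insert_eq hr, Finset.card_image_of_injOn (symOn_insert_inj hr), Finset.card_product,
      Finset.card_insert_of_notMem hr]
    push_cast; ring
  rw [h1]
  unfold avg
  rw [hc, symOn_insert_eq hr, Finset.sum_image (symOn_insert_inj hr), Finset.sum_product,
    smul_mul_assoc, Finset.sum_mul, smul_smul]
  congr 1
  · have := (symOn_card_pos B).ne'
    have h2 : ((B.card : ℝ) + 1) ≠ 0 := by positivity
    field_simp
  · refine Finset.sum_congr rfl fun g _ => ?_
    rw [Finset.mul_sum]
    simp

lemma avg_mul_avg {B C : Finset α} (h : B ⊆ C) : avg R B * avg R C = avg R C := by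
  conv_lhs => unfold avg
  rw [smul_mul_assoc, Finset.sum_mul]
  have : ∀ g ∈ symOn B, R g * (((symOn C).card : ℝ)⁻¹ • ∑ g ∈ symOn C, R g) = avg R C := by
    intro g hg
    exact mul_avg R (symOn_mono h hg)
  rw [Finset.sum_congr rfl this, Finset.sum_const, ← Nat.cast_smul_eq_nsmul ℝ, smul_smul,
    inv_mul_cancel₀ (symOn_card_pos B).ne', one_smul]

/-- two permutations sending `H = Qᶜ` into `Q` lie in the same double coset -/
lemma doubleCoset {Q : Finset α} {g g' : Perm α} (hg : ∀ x, x ∉ Q → g x ∈ Q)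
    (hg' : ∀ x, x ∉ Q → g' x ∈ Q) :
    avg R Q * R g * avg R Q = avg R Q * R g' * avg R Q := by
  classical
  obtain ⟨a, ha1, ha2⟩ : ∃ a : Perm α, a ∈ symOn Q ∧ ∀ x, x ∉ Q → a (g x) = g' x := by
    let H := {x : α // x ∉ Q}
    let e1 : (H ⊕ H) ↪ α := ⟨Sum.elim (fun x => x.1) (fun x => g x.1), by
      rintro (⟨x, hx⟩ | ⟨x, hx⟩) (⟨y, hy⟩ | ⟨y, hy⟩) h
      · obtain rfl : x = y := by simpa using h
        rfl
      · simp only [Sum.elim_inl, Sum.elim_inr] at h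
        exact absurd (h ▸ hg y hy) hx
      · simp only [Sum.elim_inl, Sum.elim_inr] at h
        exact absurd (h ▸ hg x hx) hy
      · obtain rfl : x = y := by simpa using h
        rfl⟩
    let e2 : (H ⊕ H) ↪ α := ⟨Sum.elim (fun x => x.1) (fun x => g' x.1), by
      rintro (⟨x, hx⟩ | ⟨x, hx⟩) (⟨y, hy⟩ | ⟨y, hy⟩) h
      · obtain rfl : x = y := by simpa using h
        rfl
      · simp only [Sum.elim_inl, Sum.elim_inr] at h
        exact absurd (h ▸ hg' y hy) hx
      · simp only [Sum.elim_inl, Sum.elim_inr] at h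
        exact absurd (h ▸ hg' x hx) hy
      · obtain rfl : x = y := by simpa using h
        rfl⟩
    let E : {x // x ∈ Set.range e1} ≃ {x // x ∈ Set.range e2} :=
      (Equiv.ofInjective e1 e1.injective).symm.trans (Equiv.ofInjective e2 e2.injective)
    have hE : ∀ z, E.extendSubtype (e1 z) = e2 z := by
      intro z
      rw [Equiv.extendSubtype_apply_of_mem E (e1 z) ⟨z, rfl⟩]
      have : (⟨e1 z, ⟨z, rfl⟩⟩ : {x // x ∈ Set.range e1}) = Equiv.ofInjective e1 e1.injective z := rfl
      rw [this]
      simp [E]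
    refine ⟨E.extendSubtype, ?_, ?_⟩
    · rw [mem_symOn]
      intro x hx
      exact hE (Sum.inl ⟨x, hx⟩)
    · intro x hx
      exact hE (Sum.inr ⟨x, hx⟩)
  have hb : (a * g)⁻¹ * g' ∈ symOn Q := by
    rw [mem_symOn]
    intro x hx
    rw [Perm.mul_apply, Perm.inv_eq_iff_eq, Perm.mul_apply, ha2 x hx]
  have h1 : R g' = R a * R g * R ((a * g)⁻¹ * g') := by
    rw [← map_mul, ← map_mul]; congr 1; group
  rw [h1, ← mul_assoc, ← mul_assoc, avg_mul R ha1, mul_assoc (avg R Q * R g), mul_avg R hb]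

/-- transpositions inside `Q` -/
def swapsIn (Q : Finset α) : Finset (Perm α) := Q.offDiag.image (fun p => swap p.1 p.2)

lemma mem_swapsIn {Q : Finset α} {s : Perm α} :
    s ∈ swapsIn Q ↔ ∃ a b, a ∈ Q ∧ b ∈ Q ∧ a ≠ b ∧ s = swap a b := by
  simp only [swapsIn, Finset.mem_image, Finset.mem_offDiag, Prod.exists]
  constructor
  · rintro ⟨a, b, ⟨h1, h2, h3⟩, rfl⟩; exact ⟨a, b, h1, h2, h3, rfl⟩
  · rintro ⟨a, b, h1, h2, h3, rfl⟩; exact ⟨a, b, ⟨h1, h2, h3⟩, rfl⟩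

lemma swapsIn_card_le (Q : Finset α) : (swapsIn Q).card ≤ Q.card ^ 2 := by
  refine Finset.card_image_le.trans ?_
  rw [Finset.offDiag_card, sq]; omega

lemma cross_inj {B Q : Finset α} :
    Set.InjOn (fun p : α × α => swap p.1 p.2) (B ×ˢ (Q \ B) : Finset _) := by
  rintro ⟨a, b⟩ h1 ⟨c, d⟩ h2 h
  simp only [Finset.coe_product, Set.mem_prod, Finset.mem_coe, Finset.mem_sdiff] at h1 h2 h
  have hab : a ≠ b := by rintro rfl; exact h1.2.2 h1.1
  have e : swap c d a = b := by rw [← h]; simp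
  by_cases hac : a = c
  · subst hac
    simp at e; simp [e]
  · by_cases had : a = d
    · subst had; exact absurd h1.1 h2.2.2
    · rw [swap_apply_of_ne_of_ne hac had] at e; exact absurd e hab

lemma cross_subset {B Q : Finset α} (hB : B ⊆ Q) :
    (B ×ˢ (Q \ B)).image (fun p : α × α => swap p.1 p.2) ⊆ swapsIn Q := by
  intro s hs
  simp only [Finset.mem_image, Finset.mem_product, Finset.mem_sdiff, Prod.exists] at hs
  obtain ⟨a, b, ⟨h1, h2, h3⟩, rfl⟩ := hs
  exact mem_swapsIn.2 ⟨a, b, hB h1, h2, fun h => h3 (h ▸ h1), rfl⟩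

lemma swapsIn_card_ge (Q : Finset α) (k : ℕ) (hk : k ≤ Q.card) :
    k * (Q.card - k) ≤ (swapsIn Q).card := by
  obtain ⟨B, hB, rfl⟩ := Finset.exists_subset_card_eq hk
  have := Finset.card_le_card (cross_subset hB)
  rwa [Finset.card_image_of_injOn cross_inj, Finset.card_product, Finset.card_sdiff_of_subset hB]
    at this

/-- the lazy element of a set of group elements -/
noncomputable def lazyElt (S : Finset (Perm α)) : A :=
  (1 / 2 : ℝ) • (1 : A) + (1 / (2 * (S.card : ℝ))) • ∑ s ∈ S, R s

lemma lazyElt_norm [NormOneClass A] (hR : ∀ g, ‖R g‖ ≤ 1) (S : Finset (Perm α)) :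
    ‖lazyElt R S‖ ≤ 1 := by
  unfold lazyElt
  have h2 : ‖(1 / (2 * (S.card : ℝ))) • ∑ s ∈ S, R s‖ ≤ 1 / 2 := by
    rw [norm_smul, Real.norm_eq_abs, abs_of_nonneg (by positivity)]
    have : ‖∑ s ∈ S, R s‖ ≤ S.card := by
      calc ‖∑ g ∈ S, R g‖ ≤ ∑ g ∈ S, ‖R g‖ := norm_sum_le _ _
        _ ≤ ∑ g ∈ S, 1 := Finset.sum_le_sum (fun g _ => hR g)
        _ = _ := by simp
    calc 1 / (2 * (S.card : ℝ)) * ‖∑ s ∈ S, R s‖ ≤ 1 / (2 * (S.card : ℝ)) * S.card := by gcongr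
      _ ≤ 1 / 2 := by
        rcases Nat.eq_zero_or_pos S.card with h | h
        · simp [h]
        · have : (0:ℝ) < S.card := by exact_mod_cast h
          field_simp; rfl
  calc _ ≤ ‖(1 / 2 : ℝ) • (1 : A)‖ + _ := norm_add_le _ _
    _ ≤ 1 / 2 + 1 / 2 := by
      refine add_le_add ?_ h2
      rw [norm_smul]; simp
    _ = 1 := by norm_num

lemma lazyElt_comm {Q : Finset α} {g : Perm α} (hg : g ∈ symOn Q) :
    R g * lazyElt R (swapsIn Q) = lazyElt R (swapsIn Q) * R g := by
  have hgQ : ∀ {h : Perm α}, h ∈ symOn Q → ∀ a, a ∈ Q → h a ∈ Q := by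
    intro h hh a ha
    by_contra hc
    have := mem_symOn.1 hh _ hc
    rw [h.injective this] at hc
    exact hc ha
  have hconj : ∀ {h : Perm α}, h ∈ symOn Q → ∀ s ∈ swapsIn Q, h * s * h⁻¹ ∈ swapsIn Q := by
    intro h hh s hs
    obtain ⟨a, b, ha, hb, hab, rfl⟩ := mem_swapsIn.1 hs
    refine mem_swapsIn.2 ⟨h a, h b, hgQ hh a ha, hgQ hh b hb, fun e => hab (h.injective e), ?_⟩
    rw [Equiv.swap_apply_apply]
  unfold lazyElt
  rw [mul_add, add_mul, mul_smul_comm, smul_mul_assoc, mul_one, one_mul, mul_smul_comm,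
    smul_mul_assoc, Finset.mul_sum, Finset.sum_mul]
  congr 2
  refine Finset.sum_bij' (fun s _ => g * s * g⁻¹) (fun s _ => g⁻¹ * s * g) ?_ ?_ ?_ ?_ ?_
  · intro s hs; exact hconj hg s hs
  · intro s hs; simpa using hconj (symOn_inv hg) s hs
  · intro s hs; group
  · intro s hs; group
  · intro s hs; rw [← map_mul, ← map_mul]; congr 1; group


lemma hubmix_key (N k c : ℝ) (hN5 : 5 ≤ N) (hk0 : 0 ≤ k) (hkN : k ≤ N)
    (hcge : 1 / (2 * N ^ 2) ≤ c) :
    c * (N - k) * (N + 1) / (k + 1 + 1) ≥ (N - k) / (k + 1) * (1 / (4 * N)) := by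
  have h0 : 0 ≤ N - k := by linarith
  have hNpos : 0 < N := by linarith
  have h1 : (1 / (2 * N ^ 2)) * (N - k) * (N + 1) / (k + 1 + 1) ≤
      c * (N - k) * (N + 1) / (k + 1 + 1) := by gcongr
  refine le_trans ?_ h1
  have e1 : (1 / (2 * N ^ 2)) * (N - k) * (N + 1) / (k + 1 + 1) =
      (N - k) * ((N + 1) / (2 * N ^ 2 * (k + 2))) := by field_simp; ring
  have e2 : (N - k) / (k + 1) * (1 / (4 * N)) = (N - k) * (1 / (4 * N * (k + 1))) := by
    field_simp
  rw [e1, e2]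
  apply mul_le_mul_of_nonneg_left _ h0
  rw [div_le_div_iff₀ (by positivity) (by positivity)]
  have h2 : 0 ≤ N * (2 * N * k + 4 * (k + 1)) := by positivity
  nlinarith [h2]

lemma hubmix_expand (N k c D s : ℝ) (hk0 : 0 ≤ k) (hcS : c * s = 1 / 2) :
    c * (k + 1) * ((N - k) * (D * ((N - (k + 1)) / (k + 1 + 1)))) +
        (1 / 2 - c * (N - k)) * (D * ((N - k) / (k + 1))) +
        c * ((s - k * (N - k)) * (D * ((N - k) / (k + 1)))) =
        D * ((N - k) / (k + 1) - c * (N - k) * (N + 1) / (k + 1 + 1)) := by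
  have : c * ((s - k * (N - k)) * (D * ((N - k) / (k + 1)))) =
    (1 / 2 - c * (k * (N - k))) * (D * ((N - k) / (k + 1))) := by rw [← hcS]; ring
  rw [this]
  field_simp
  ring

set_option maxHeartbeats 1000000 in
lemma hubmix [NormOneClass A] (hR : ∀ g, ‖R g‖ ≤ 1) (Q : Finset α) (hN : 5 ≤ Q.card) (t : ℕ) :
    ∀ B ⊆ Q, ‖avg R B * lazyElt R (swapsIn Q) ^ t - avg R Q‖ ≤
      2 * (Q.card : ℝ) * (((Q.card : ℝ) - B.card) / (B.card + 1)) * (1 - 1 / (4 * (Q.card : ℝ))) ^ t := by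
  set N : ℝ := (Q.card : ℝ) with hNdef
  have hN5 : (5 : ℝ) ≤ N := by rw [hNdef]; exact_mod_cast hN
  induction t with
  | zero =>
    intro B hB
    rw [pow_zero, mul_one, pow_zero, mul_one]
    by_cases h : B = Q
    · subst h; simp [hNdef]
    · have hlt : B.card < Q.card := Finset.card_lt_card (hB.ssubset_of_ne h)
      have hlt' : (B.card : ℝ) + 1 ≤ N := by rw [hNdef]; exact_mod_cast hlt
      have h1 : ‖avg R B - avg R Q‖ ≤ 2 := by
        calc _ ≤ ‖avg R B‖ + ‖avg R Q‖ := norm_sub_le _ _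
          _ ≤ 1 + 1 := add_le_add (avg_norm R hR B) (avg_norm R hR Q)
          _ = 2 := by norm_num
      refine h1.trans ?_
      have hk : (0 : ℝ) ≤ B.card := by positivity
      rw [mul_div_assoc', le_div_iff₀ (by positivity)]
      nlinarith
  | succ t ih =>
    intro B hB
    set S := swapsIn Q with hS
    set T := lazyElt R S with hT
    set k : ℝ := (B.card : ℝ) with hk
    set c : ℝ := 1 / (2 * (S.card : ℝ)) with hc
    have hk0 : 0 ≤ k := by positivity
    have hkN : k ≤ N := by rw [hk, hNdef]; exact_mod_cast Finset.card_le_card hB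
    have hSge : N ≤ (S.card : ℝ) := by
      have h2 := swapsIn_card_ge Q 2 (by omega)
      have : Q.card ≤ (swapsIn Q).card := by omega
      rw [hNdef]; exact_mod_cast this
    have hSle : (S.card : ℝ) ≤ N ^ 2 := by
      rw [hNdef]; exact_mod_cast swapsIn_card_le Q
    have hSpos : (0 : ℝ) < S.card := by linarith
    have hc0 : 0 < c := by positivity
    have hcS : c * S.card = 1 / 2 := by rw [hc]; field_simp
    have hcge : 1 / (2 * N ^ 2) ≤ c := by
      rw [hc]; apply one_div_le_one_div_of_le (by positivity); linarith
    have hcN : c * (N - k) ≤ 1 / 2 := by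
      rw [← hcS]; apply mul_le_mul_of_nonneg_left _ hc0.le; linarith
    set ρ : ℝ := 1 - 1 / (4 * N) with hρ
    have hρ0 : 0 ≤ ρ := by
      rw [hρ, sub_nonneg, div_le_one (by positivity)]; linarith
    set X := (B ×ˢ (Q \ B)).image (fun p : α × α => swap p.1 p.2) with hX
    have hXS : X ⊆ S := cross_subset hB
    have hQB : ((Q \ B).card : ℝ) = N - k := by
      rw [Finset.card_sdiff_of_subset hB, Nat.cast_sub (Finset.card_le_card hB)]
    have hXcard : (X.card : ℝ) = k * (N - k) := by
      rw [hX, Finset.card_image_of_injOn cross_inj, Finset.card_product]; push_cast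
      rw [hQB]
    have hSXcard : ((S \ X).card : ℝ) = S.card - k * (N - k) := by
      rw [Finset.card_sdiff_of_subset hXS, Nat.cast_sub (Finset.card_le_card hXS), hXcard]
    have hTdec : T = c • ∑ r ∈ Q \ B, (1 + ∑ j ∈ B, R (swap j r)) + (1 / 2 - c * (N - k)) • (1 : A)
        + c • ∑ s ∈ S \ X, R s := by
      have e1 : ∑ s ∈ S, R s = ∑ s ∈ S \ X, R s + ∑ s ∈ X, R s := (Finset.sum_sdiff hXS).symm
      have e2 : ∑ s ∈ X, R s = ∑ r ∈ Q \ B, ∑ j ∈ B, R (swap j r) := by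
        rw [hX, Finset.sum_image cross_inj, Finset.sum_product_right]
      rw [hT, lazyElt, e1, e2, Finset.sum_add_distrib, Finset.sum_const, ← Nat.cast_smul_eq_nsmul ℝ,
        hQB]
      rw [← hc]
      module
    have hmain : avg R B * T ^ (t + 1) - avg R Q =
        (c * (k + 1)) • ∑ r ∈ Q \ B, (avg R (insert r B) * T ^ t - avg R Q)
        + (1 / 2 - c * (N - k)) • (avg R B * T ^ t - avg R Q)
        + c • ∑ s ∈ S \ X, (avg R B * T ^ t - avg R Q) * R s := by
      have e3 : ∀ s ∈ S \ X, (avg R B * T ^ t - avg R Q) * R s = avg R B * R s * T ^ t - avg R Q := by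
        intro s hs
        obtain ⟨a, b, ha, hb, hab, rfl⟩ := mem_swapsIn.1 (Finset.mem_sdiff.1 hs).1
        have hsQ := symOn_swap ha hb
        have hcomm : Commute (R (swap a b)) (T ^ t) :=
          Commute.pow_right (lazyElt_comm R hsQ) t
        rw [sub_mul, avg_mul R hsQ, mul_assoc, mul_assoc, hcomm.eq]
      have e4 : ∀ r ∈ Q \ B, avg R B * (1 + ∑ j ∈ B, R (swap j r)) = (k + 1) • avg R (insert r B) :=
        fun r hr => avg_insert R (Finset.mem_sdiff.1 hr).2
      rw [Finset.sum_congr rfl e3, Finset.sum_sub_distrib, Finset.sum_sub_distrib, Finset.sum_const,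
        Finset.sum_const, ← Nat.cast_smul_eq_nsmul ℝ, ← Nat.cast_smul_eq_nsmul ℝ, hQB, hSXcard,
        pow_succ', ← mul_assoc]
      have e6 : avg R B * T = c • ∑ r ∈ Q \ B, (k + 1) • avg R (insert r B)
          + (1 / 2 - c * (N - k)) • avg R B + c • ∑ s ∈ S \ X, avg R B * R s := by
        rw [← Finset.sum_congr rfl e4, ← Finset.mul_sum, ← Finset.mul_sum]
        conv_lhs => rw [hTdec]
        rw [mul_add, mul_add, mul_smul_comm, mul_smul_comm, mul_one, mul_smul_comm]
      rw [e6, add_mul, add_mul, smul_mul_assoc,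
        smul_mul_assoc, smul_mul_assoc, Finset.sum_mul, Finset.sum_mul]
      simp only [smul_mul_assoc, smul_sub, smul_smul, ← Finset.smul_sum]
      have e5 : (avg R Q : A) = (c * (k + 1) * (N - k)) • avg R Q + (1 / 2 - c * (N - k)) • avg R Q
          + (c * (S.card - k * (N - k))) • avg R Q := by
        rw [← add_smul, ← add_smul]
        conv_lhs => rw [← one_smul ℝ (avg R Q)]
        congr 1
        linear_combination (-1 : ℝ) * hcS
      conv_lhs => rw [e5]
      abel
    rw [hmain]
    set D : ℝ := 2 * N * ρ ^ t with hD
    have hD0 : 0 ≤ D := by positivity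
    have ihB : ‖avg R B * T ^ t - avg R Q‖ ≤ D * ((N - k) / (k + 1)) := by
      have := ih B hB
      rw [hD]; linarith
    have n1 : ‖(c * (k + 1)) • ∑ r ∈ Q \ B, (avg R (insert r B) * T ^ t - avg R Q)‖ ≤
        c * (k + 1) * ((N - k) * (D * ((N - (k + 1)) / (k + 1 + 1)))) := by
      rw [norm_smul, Real.norm_eq_abs, abs_of_nonneg (by positivity)]
      apply mul_le_mul_of_nonneg_left _ (by positivity)
      calc _ ≤ ∑ r ∈ Q \ B, ‖avg R (insert r B) * T ^ t - avg R Q‖ := norm_sum_le _ _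
        _ ≤ ∑ r ∈ Q \ B, (D * ((N - (k + 1)) / (k + 1 + 1))) := by
          refine Finset.sum_le_sum fun r hr => ?_
          have hr' := Finset.mem_sdiff.1 hr
          have := ih (insert r B) (Finset.insert_subset hr'.1 hB)
          rw [Finset.card_insert_of_notMem hr'.2] at this
          push_cast at this
          rw [hD]; linarith
        _ = _ := by rw [Finset.sum_const, nsmul_eq_mul, hQB]
    have n2 : ‖(1 / 2 - c * (N - k)) • (avg R B * T ^ t - avg R Q)‖ ≤
        (1 / 2 - c * (N - k)) * (D * ((N - k) / (k + 1))) := by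
      rw [norm_smul, Real.norm_eq_abs, abs_of_nonneg (by linarith)]
      exact mul_le_mul_of_nonneg_left ihB (by linarith)
    have n3 : ‖c • ∑ s ∈ S \ X, (avg R B * T ^ t - avg R Q) * R s‖ ≤
        c * ((S.card - k * (N - k)) * (D * ((N - k) / (k + 1)))) := by
      rw [norm_smul, Real.norm_eq_abs, abs_of_nonneg hc0.le]
      apply mul_le_mul_of_nonneg_left _ hc0.le
      calc _ ≤ ∑ s ∈ S \ X, ‖(avg R B * T ^ t - avg R Q) * R s‖ := norm_sum_le _ _
        _ ≤ ∑ s ∈ S \ X, (D * ((N - k) / (k + 1))) := by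
          refine Finset.sum_le_sum fun s _ => ?_
          calc _ ≤ ‖avg R B * T ^ t - avg R Q‖ * ‖R s‖ := norm_mul_le _ _
            _ ≤ ‖avg R B * T ^ t - avg R Q‖ * 1 := by gcongr; exact hR s
            _ ≤ _ := by rw [mul_one]; exact ihB
        _ = _ := by rw [Finset.sum_const, nsmul_eq_mul, hSXcard]
    refine (norm_add_le _ _).trans ((add_le_add ((norm_add_le _ _).trans (add_le_add n1 n2)) n3).trans ?_)
    have hk1 : 0 < k + 1 := by linarith
    have hk2 : 0 < k + 1 + 1 := by linarith
    have key := hubmix_key N k c hN5 hk0 hkN hcge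
    have expand := hubmix_expand N k c D S.card hk0 hcS
    rw [expand, pow_succ]
    calc _ ≤ D * ((N - k) / (k + 1) - (N - k) / (k + 1) * (1 / (4 * N))) := by gcongr
      _ = _ := by rw [hD, hρ]; ring

lemma pow_sub_pow_norm [NormOneClass A] {x y : A} (hx : ‖x‖ ≤ 1) (hy : ‖y‖ ≤ 1) (t : ℕ) :
    ‖x ^ t - y ^ t‖ ≤ t * ‖x - y‖ := by
  induction t with
  | zero => simp
  | succ t ih =>
    have : x ^ (t + 1) - y ^ (t + 1) = x ^ t * (x - y) + (x ^ t - y ^ t) * y := by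
      rw [pow_succ, pow_succ]; noncomm_ring
    rw [this]
    calc _ ≤ ‖x ^ t * (x - y)‖ + ‖(x ^ t - y ^ t) * y‖ := norm_add_le _ _
      _ ≤ ‖x ^ t‖ * ‖x - y‖ + ‖x ^ t - y ^ t‖ * ‖y‖ := add_le_add (norm_mul_le _ _) (norm_mul_le _ _)
      _ ≤ 1 * ‖x - y‖ + (t * ‖x - y‖) * 1 := by
        gcongr
        exact (norm_pow_le _ _).trans (pow_le_one₀ (norm_nonneg _) hx)
      _ = _ := by push_cast; ring

/-- distance between the lazy elements of nested generating sets -/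
lemma lazyElt_sub_norm (hR : ∀ g, ‖R g‖ ≤ 1) {S S' : Finset (Perm α)} (h : S ⊆ S')
    (hS : S.Nonempty) :
    ‖lazyElt R S' - lazyElt R S‖ ≤ ((S' \ S).card : ℝ) / S'.card := by
  have hSp : (0 : ℝ) < S.card := by exact_mod_cast hS.card_pos
  have hSp' : (0 : ℝ) < S'.card := by exact_mod_cast (hS.mono h).card_pos
  have hcard : ((S' \ S).card : ℝ) = S'.card - S.card := by
    rw [Finset.card_sdiff_of_subset h, Nat.cast_sub (Finset.card_le_card h)]
  have hle : (S.card : ℝ) ≤ S'.card := by exact_mod_cast Finset.card_le_card h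
  have e : lazyElt R S' - lazyElt R S = (1 / (2 * (S'.card : ℝ))) • ∑ s ∈ S' \ S, R s
      - (1 / (2 * (S.card : ℝ)) - 1 / (2 * (S'.card : ℝ))) • ∑ s ∈ S, R s := by
    unfold lazyElt
    rw [← Finset.sum_sdiff h, smul_add, sub_smul]; abel
  have bd : ∀ U : Finset (Perm α), ‖∑ s ∈ U, R s‖ ≤ U.card := by
    intro U
    calc ‖∑ g ∈ U, R g‖ ≤ ∑ g ∈ U, ‖R g‖ := norm_sum_le _ _
      _ ≤ ∑ g ∈ U, 1 := Finset.sum_le_sum (fun g _ => hR g)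
      _ = _ := by simp
  rw [e]
  refine (norm_sub_le _ _).trans ?_
  rw [norm_smul, norm_smul, Real.norm_eq_abs, Real.norm_eq_abs, abs_of_nonneg (by positivity),
    abs_of_nonneg (by rw [sub_nonneg]; apply one_div_le_one_div_of_le <;> linarith)]
  calc _ ≤ (1 / (2 * (S'.card : ℝ))) * (S' \ S).card +
        (1 / (2 * (S.card : ℝ)) - 1 / (2 * (S'.card : ℝ))) * S.card := by
        gcongr
        · exact bd _
        · rw [sub_nonneg]; apply one_div_le_one_div_of_le <;> linarith
        · exact bd _
    _ = _ := by rw [hcard]; field_simp; ring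

lemma mixCore (hR : ∀ g, ‖R g‖ ≤ 1) (Q : Finset α) (μ ν : Perm α → ℝ)
    (hμ : ∀ g, 0 ≤ μ g) (hν : ∀ g, 0 ≤ ν g) (hμ1 : ∑ g, μ g = 1) (hν1 : ∑ g, ν g = 1)
    (D : Finset (Perm α)) (hD : ∀ g, g ∈ D ↔ ∀ x, x ∉ Q → g x ∈ Q) :
    ‖avg R Q * (∑ g, μ g • R g) * avg R Q - avg R Q * (∑ g, ν g • R g) * avg R Q‖ ≤
      2 * (∑ g ∈ Dᶜ, μ g + ∑ g ∈ Dᶜ, ν g) := by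
  set f := avg R Q with hf
  have hfn : ‖f‖ ≤ 1 := avg_norm R hR Q
  have hn : ∀ g, ‖f * R g * f‖ ≤ 1 := by
    intro g
    calc _ ≤ ‖f * R g‖ * ‖f‖ := norm_mul_le _ _
      _ ≤ (‖f‖ * ‖R g‖) * ‖f‖ := by gcongr; exact norm_mul_le _ _
      _ ≤ (1 * 1) * 1 := by gcongr; exact hR g
      _ = 1 := by norm_num
  have e : f * (∑ g, μ g • R g) * f - f * (∑ g, ν g • R g) * f =
      ∑ g, (μ g - ν g) • (f * R g * f) := by
    rw [Finset.mul_sum, Finset.mul_sum, Finset.sum_mul, Finset.sum_mul, ← Finset.sum_sub_distrib]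
    refine Finset.sum_congr rfl fun g _ => ?_
    rw [mul_smul_comm, mul_smul_comm, smul_mul_assoc, smul_mul_assoc, sub_smul]
  have habs : ∀ U : Finset (Perm α), |∑ g ∈ U, (μ g - ν g)| ≤ ∑ g ∈ U, μ g + ∑ g ∈ U, ν g := by
    intro U
    rw [← Finset.sum_add_distrib]
    refine (Finset.abs_sum_le_sum_abs _ _).trans (Finset.sum_le_sum fun g _ => ?_)
    rw [abs_le]; constructor <;> linarith [hμ g, hν g]
  have p2 : ‖∑ g ∈ Dᶜ, (μ g - ν g) • (f * R g * f)‖ ≤ ∑ g ∈ Dᶜ, μ g + ∑ g ∈ Dᶜ, ν g := by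
    rw [← Finset.sum_add_distrib]
    refine (norm_sum_le _ _).trans (Finset.sum_le_sum fun g _ => ?_)
    rw [norm_smul]
    calc _ ≤ ‖μ g - ν g‖ * 1 := by gcongr; exact hn g
      _ ≤ _ := by
        rw [mul_one, Real.norm_eq_abs, abs_le]; constructor <;> linarith [hμ g, hν g]
  have p1 : ‖∑ g ∈ D, (μ g - ν g) • (f * R g * f)‖ ≤ ∑ g ∈ Dᶜ, μ g + ∑ g ∈ Dᶜ, ν g := by
    rcases D.eq_empty_or_nonempty with h | ⟨g0, hg0⟩
    · rw [h]
      simp only [Finset.sum_empty, norm_zero]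
      exact add_nonneg (Finset.sum_nonneg fun g _ => hμ g) (Finset.sum_nonneg fun g _ => hν g)
    · have : ∀ g ∈ D, (μ g - ν g) • (f * R g * f) = (μ g - ν g) • (f * R g0 * f) := by
        intro g hg
        rw [hf, doubleCoset R ((hD g).1 hg) ((hD g0).1 hg0)]
      rw [Finset.sum_congr rfl this, ← Finset.sum_smul, norm_smul]
      have tot : ∑ g ∈ D, (μ g - ν g) = -∑ g ∈ Dᶜ, (μ g - ν g) := by
        have := Finset.sum_add_sum_compl D (fun g => μ g - ν g)
        rw [Finset.sum_sub_distrib, Finset.sum_sub_distrib, Finset.sum_sub_distrib] at this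
        rw [Finset.sum_sub_distrib, Finset.sum_sub_distrib]
        linarith
      calc _ ≤ ‖∑ g ∈ D, (μ g - ν g)‖ * 1 := by gcongr; exact hn g0
        _ ≤ _ := by rw [mul_one, Real.norm_eq_abs, tot, abs_neg]; exact habs _
  rw [e, ← Finset.sum_add_sum_compl D]
  refine (norm_add_le _ _).trans ?_
  linarith

end abstractPart

set_option linter.unusedSectionVars false
set_option linter.unusedVariables false

section walkPart
open Equiv

variable {α : Type*} [Fintype α] [DecidableEq α]

/-- law of the lazy walk at time `t` -/
noncomputable def mu (S : Finset (Perm α)) : ℕ → Perm α → ℝ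
  | 0, g => if g = 1 then 1 else 0
  | t + 1, g => 1 / 2 * mu S t g + 1 / (2 * (S.card : ℝ)) * ∑ s ∈ S, mu S t (g * s⁻¹)

lemma mu_nonneg (S : Finset (Perm α)) (t : ℕ) : ∀ g, 0 ≤ mu S t g := by
  induction t with
  | zero => intro g; simp only [mu]; split_ifs <;> norm_num
  | succ t ih =>
    intro g
    simp only [mu]
    have h1 := ih g
    have h2 : 0 ≤ ∑ s ∈ S, mu S t (g * s⁻¹) := Finset.sum_nonneg fun s _ => ih _
    positivity

lemma mu_sum_succ {E : Type*} [AddCommGroup E] [Module ℝ E] (S : Finset (Perm α)) (t : ℕ)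
    (F : Perm α → E) :
    ∑ g, mu S (t + 1) g • F g = (1 / 2 : ℝ) • ∑ g, mu S t g • F g +
      (1 / (2 * (S.card : ℝ))) • ∑ s ∈ S, ∑ g, mu S t g • F (g * s) := by
  simp only [mu, add_smul, Finset.sum_add_distrib, mul_smul, ← Finset.smul_sum]
  congr 2
  simp only [Finset.sum_smul]
  rw [Finset.sum_comm]
  refine Finset.sum_congr rfl fun s _ => ?_
  rw [← Equiv.sum_comp (Equiv.mulRight s)]
  simp

lemma mu_sum_one (S : Finset (Perm α)) (hS : S.Nonempty) (t : ℕ) : ∑ g, mu S t g = 1 := by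
  induction t with
  | zero => simp [mu]
  | succ t ih =>
    have := mu_sum_succ S t (fun _ => (1 : ℝ))
    simp only [smul_eq_mul, mul_one, ih, Finset.sum_const, nsmul_eq_mul] at this
    rw [this]
    have : (0 : ℝ) < S.card := by exact_mod_cast hS.card_pos
    field_simp; norm_num

lemma lazyElt_pow {A : Type*} [NormedRing A] [NormedAlgebra ℝ A] (R : Perm α →* A)
    (S : Finset (Perm α)) (t : ℕ) : lazyElt R S ^ t = ∑ g, mu S t g • R g := by
  induction t with
  | zero => simp [mu]
  | succ t ih =>
    rw [mu_sum_succ, pow_succ, ih, lazyElt, mul_add, mul_smul_comm, mul_one, mul_smul_comm,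
      Finset.mul_sum]
    congr 2
    refine Finset.sum_congr rfl fun s _ => ?_
    rw [Finset.sum_mul]
    refine Finset.sum_congr rfl fun g _ => ?_
    rw [map_mul, smul_mul_assoc]

/-- expected value of `f` at the position of the particle `x` at time `t` -/
noncomputable def Fpart (S : Finset (Perm α)) (f : α → ℝ) (t : ℕ) (x : α) : ℝ :=
  ∑ g, mu S t g * f (g x)

lemma Fpart_zero (S : Finset (Perm α)) (f : α → ℝ) (x : α) : Fpart S f 0 x = f x := by
  simp [Fpart, mu]

lemma Fpart_succ (S : Finset (Perm α)) (f : α → ℝ) (t : ℕ) (x : α) :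
    Fpart S f (t + 1) x = 1 / 2 * Fpart S f t x +
      1 / (2 * (S.card : ℝ)) * ∑ s ∈ S, Fpart S f t (s x) := by
  have := mu_sum_succ S t (fun g => f (g x))
  simpa [Fpart] using this

lemma Fpart_succ' (S : Finset (Perm α)) (hS : S.Nonempty) (f : α → ℝ) (t : ℕ) (x : α) :
    Fpart S f (t + 1) x = Fpart S f t x +
      1 / (2 * (S.card : ℝ)) * ∑ s ∈ S, (Fpart S f t (s x) - Fpart S f t x) := by
  rw [Fpart_succ, Finset.sum_sub_distrib, Finset.sum_const, nsmul_eq_mul]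
  have : (0 : ℝ) < S.card := by exact_mod_cast hS.card_pos
  field_simp; ring

/-- transpositions along the edges of a graph -/
def gens (Adj : α → α → Prop) [DecidableRel Adj] : Finset (Perm α) :=
  (univ.filter (fun p : α × α => Adj p.1 p.2)).image (fun p => swap p.1 p.2)

lemma mem_gens {Adj : α → α → Prop} [DecidableRel Adj] {s : Perm α} :
    s ∈ gens Adj ↔ ∃ a b, Adj a b ∧ s = swap a b := by
  simp only [gens, Finset.mem_image, Finset.mem_filter, Finset.mem_univ, true_and, Prod.exists]
  constructor
  · rintro ⟨a, b, h, rfl⟩; exact ⟨a, b, h, rfl⟩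
  · rintro ⟨a, b, h, rfl⟩; exact ⟨a, b, h, rfl⟩

lemma gens_sum (Adj : α → α → Prop) [DecidableRel Adj] (hs : ∀ a b, Adj a b → Adj b a)
    (hi : ∀ a, ¬ Adj a a) (f : α → ℝ) (x : α) :
    ∑ s ∈ gens Adj, (f (s x) - f x) = ∑ y, if Adj x y then f y - f x else 0 := by
  rw [← Finset.sum_filter]
  have hsub : (univ.filter (fun y => Adj x y)).image (fun y => swap x y) ⊆ gens Adj := by
    intro s hs
    simp only [Finset.mem_image, Finset.mem_filter, Finset.mem_univ, true_and] at hs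
    obtain ⟨y, hy, rfl⟩ := hs
    exact mem_gens.2 ⟨x, y, hy, rfl⟩
  rw [← Finset.sum_subset hsub, Finset.sum_image]
  · refine Finset.sum_congr rfl fun y _ => ?_
    simp
  · intro y _ y' _ h
    have := congrArg (fun s : Perm α => s x) h
    simpa using this
  · intro s hs1 hs2
    obtain ⟨a, b, hab, rfl⟩ := mem_gens.1 hs1
    rw [swap_apply_of_ne_of_ne, sub_self]
    · rintro rfl
      exact hs2 (Finset.mem_image.2 ⟨b, by simpa using hab, rfl⟩)
    · rintro rfl
      exact hs2 (Finset.mem_image.2 ⟨a, by simpa using hs _ _ hab, swap_comm _ _⟩)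

/-- graph Laplacian of a function -/
noncomputable def lap (Adj : α → α → Prop) [DecidableRel Adj] (f : α → ℝ) (x : α) : ℝ :=
  ∑ y, if Adj x y then f y - f x else 0

lemma Fpart_step (Adj : α → α → Prop) [DecidableRel Adj] (hs : ∀ a b, Adj a b → Adj b a)
    (hi : ∀ a, ¬ Adj a a) (hne : (gens Adj).Nonempty) (f : α → ℝ) (t : ℕ) (x : α) :
    Fpart (gens Adj) f (t + 1) x = Fpart (gens Adj) f t x +
      1 / (2 * ((gens Adj).card : ℝ)) * lap Adj (Fpart (gens Adj) f t) x := by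
  rw [Fpart_succ' _ hne, gens_sum Adj hs hi, lap]

lemma Fpart_le (Adj : α → α → Prop) [DecidableRel Adj] (hs : ∀ a b, Adj a b → Adj b a)
    (hi : ∀ a, ¬ Adj a a) (hne : (gens Adj).Nonempty) (f : α → ℝ) (w : ℕ → α → ℝ)
    (h0 : ∀ x, f x ≤ w 0 x)
    (hw : ∀ t x, w t x + 1 / (2 * ((gens Adj).card : ℝ)) * lap Adj (w t) x ≤ w (t + 1) x) (t : ℕ) :
    ∀ x, Fpart (gens Adj) f t x ≤ w t x := by
  induction t with
  | zero => intro x; rw [Fpart_zero]; exact h0 x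
  | succ t ih =>
    intro x
    refine le_trans ?_ (hw t x)
    have hc : (0 : ℝ) < (gens Adj).card := by exact_mod_cast hne.card_pos
    have e : w t x + 1 / (2 * ((gens Adj).card : ℝ)) * lap Adj (w t) x =
      1 / 2 * w t x + 1 / (2 * ((gens Adj).card : ℝ)) * ∑ s ∈ gens Adj, w t (s x) := by
      rw [lap, ← gens_sum Adj hs hi, Finset.sum_sub_distrib, Finset.sum_const, nsmul_eq_mul]
      field_simp; ring
    rw [e, Fpart_succ]
    gcongr
    · exact ih x
    · exact ih _

lemma Fpart_ge (Adj : α → α → Prop) [DecidableRel Adj] (hs : ∀ a b, Adj a b → Adj b a)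
    (hi : ∀ a, ¬ Adj a a) (hne : (gens Adj).Nonempty) (f u : α → ℝ) (δ : ℝ)
    (h0 : ∀ x, u x ≤ f x)
    (hw : ∀ x, -δ ≤ lap Adj u x) (t : ℕ) :
    ∀ x, u x - δ * t / (2 * ((gens Adj).card : ℝ)) ≤ Fpart (gens Adj) f t x := by
  have hc : (0 : ℝ) < (gens Adj).card := by exact_mod_cast hne.card_pos
  induction t with
  | zero => intro x; rw [Fpart_zero]; simpa using h0 x
  | succ t ih =>
    intro x
    rw [Fpart_succ]
    set e : ℝ := ((gens Adj).card : ℝ) with he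
    have h1 : ∑ s ∈ gens Adj, (u (s x) - δ * t / (2 * e)) ≤
        ∑ s ∈ gens Adj, Fpart (gens Adj) f t (s x) := Finset.sum_le_sum fun s _ => ih _
    have h2 : ∑ s ∈ gens Adj, (u (s x) - δ * t / (2 * e)) =
        lap Adj u x + e * (u x - δ * t / (2 * e)) := by
      have h3 : lap Adj u x = ∑ s ∈ gens Adj, (u (s x) - u x) := (gens_sum Adj hs hi u x).symm
      rw [h3, Finset.sum_sub_distrib, Finset.sum_sub_distrib, Finset.sum_const, Finset.sum_const,
        nsmul_eq_mul, nsmul_eq_mul]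
      ring
    have h4 : 1 / (2 * e) * (-δ + e * (u x - δ * t / (2 * e))) ≤
        1 / (2 * e) * ∑ s ∈ gens Adj, Fpart (gens Adj) f t (s x) := by
      gcongr
      linarith [hw x]
    have h5 := ih x
    have h6 : 1 / (2 * e) * (-δ + e * (u x - δ * t / (2 * e))) =
      1 / 2 * (u x - δ * t / (2 * e)) - δ / (2 * e) := by field_simp; ring
    have h7 : δ * ((t + 1 : ℕ) : ℝ) / (2 * e) = δ * t / (2 * e) + δ / (2 * e) := by
      push_cast; ring
    rw [h7]; linarith

/-- under the uniform measure the particle `x` is uniform -/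
lemma unif_part (f : α → ℝ) (x : α) :
    (Fintype.card α : ℝ) * ∑ g : Perm α, f (g x) = (Fintype.card (Perm α) : ℝ) * ∑ y, f y := by
  have h : ∀ y, ∑ g : Perm α, f (g y) = ∑ g : Perm α, f (g x) := by
    intro y
    rw [← Equiv.sum_comp (Equiv.mulRight (swap x y))]
    simp
  have h2 : ∑ y, ∑ g : Perm α, f (g y) = ∑ g : Perm α, ∑ y, f y := by
    rw [Finset.sum_comm]
    exact Finset.sum_congr rfl fun g _ => Equiv.sum_comp g f
  rw [Finset.sum_congr rfl fun y _ => h y] at h2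
  simpa using h2

end walkPart

set_option linter.unusedSectionVars false
set_option linter.unusedVariables false

section matrixPart
open Equiv
open scoped Matrix.Norms.Operator

variable {α : Type*} [Fintype α] [DecidableEq α]

/-- right regular representation -/
noncomputable def rr : Perm α →* Matrix (Perm α) (Perm α) ℝ where
  toFun g := Matrix.of fun x y => if y = x * g then 1 else 0
  map_one' := by ext x y; simp [Matrix.one_apply, eq_comm]
  map_mul' g h := by
    ext x y
    rw [Matrix.mul_apply, Finset.sum_eq_single (x * g)]
    · simp [mul_assoc]
    · intro j _ hj; simp [hj]
    · simp

lemma rr_apply (g x y : Perm α) : rr g x y = if y = x * g then 1 else 0 := rfl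

lemma comb_apply (m : Perm α → ℝ) (x y : Perm α) :
    (∑ g, m g • rr g : Matrix (Perm α) (Perm α) ℝ) x y = m (x⁻¹ * y) := by
  rw [Matrix.sum_apply]
  simp only [Matrix.smul_apply, rr_apply, smul_eq_mul, mul_ite, mul_one, mul_zero]
  rw [Finset.sum_eq_single (x⁻¹ * y)]
  · simp
  · intro g _ hg
    rw [if_neg]
    rintro rfl; simp at hg
  · simp

lemma comb_row (m : Perm α → ℝ) (x : Perm α) :
    ∑ y, ‖(∑ g, m g • rr g : Matrix (Perm α) (Perm α) ℝ) x y‖ = ∑ g, |m g| := by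
  simp only [comb_apply, Real.norm_eq_abs]
  exact Equiv.sum_comp (Equiv.mulLeft x⁻¹) (fun g => |m g|)

lemma matrix_norm_le (M : Matrix (Perm α) (Perm α) ℝ) (c : ℝ) (hc : 0 ≤ c) :
    ‖M‖ ≤ c ↔ ∀ x, ∑ y, ‖M x y‖ ≤ c := by
  lift c to NNReal using hc
  rw [Matrix.linfty_opNorm_def, NNReal.coe_le_coe, Finset.sup_le_iff]
  simp only [Finset.mem_univ, true_imp_iff, ← NNReal.coe_le_coe, NNReal.coe_sum, coe_nnnorm]

lemma comb_norm (m : Perm α → ℝ) :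
    ‖(∑ g, m g • rr g : Matrix (Perm α) (Perm α) ℝ)‖ ≤ ∑ g, |m g| := by
  rw [matrix_norm_le _ _ (Finset.sum_nonneg fun _ _ => abs_nonneg _)]
  intro x
  rw [comb_row]

lemma comb_norm_ge (m : Perm α → ℝ) :
    ∑ g, |m g| ≤ ‖(∑ g, m g • rr g : Matrix (Perm α) (Perm α) ℝ)‖ := by
  have := (matrix_norm_le (∑ g, m g • rr g : Matrix (Perm α) (Perm α) ℝ) _ (norm_nonneg _)).1 le_rfl 1
  rwa [comb_row] at this

lemma rr_norm (g : Perm α) : ‖(rr g : Matrix (Perm α) (Perm α) ℝ)‖ ≤ 1 := by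
  rw [matrix_norm_le _ _ zero_le_one]
  intro x
  simp [rr_apply, apply_ite]

lemma lazy_eq (S : Finset (Perm α)) (h1 : (1 : Perm α) ∉ S) : lazyCayleyP S = lazyElt rr S := by
  ext x y
  simp only [lazyElt, lazyCayleyP, Matrix.add_apply, Matrix.smul_apply, Matrix.sum_apply, rr_apply,
    Matrix.one_apply, smul_eq_mul]
  have h2 : (∑ s ∈ S, if y = x * s then (1 : ℝ) else 0) = if x⁻¹ * y ∈ S then 1 else 0 := by
    have : ∀ s ∈ S, (if y = x * s then (1 : ℝ) else 0) = if x⁻¹ * y = s then 1 else 0 := by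
      intro s _
      congr 1
      rw [inv_mul_eq_iff_eq_mul]
    rw [Finset.sum_congr rfl this, Finset.sum_ite_eq]
  rw [h2]
  by_cases hxy : y = x
  · subst hxy; simp [h1]
  · simp [hxy, Ne.symm hxy]

lemma lazy_pow (S : Finset (Perm α)) (h1 : (1 : Perm α) ∉ S) (t : ℕ) :
    (lazyCayleyP S) ^ t = ∑ g, mu S t g • rr g := by
  rw [lazy_eq S h1, lazyElt_pow]

lemma mixset_iff (S : Finset (Perm α)) (h1 : (1 : Perm α) ∉ S) (t : ℕ) :
    (∀ x : Perm α, (∑ y : Perm α, |(lazyCayleyP S ^ t) x y - 1 / (Fintype.card (Perm α) : ℝ)|) / 2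
      ≤ 1 / 4) ↔ ∑ g, |mu S t g - 1 / (Fintype.card (Perm α) : ℝ)| ≤ 1 / 2 := by
  have : ∀ x : Perm α, (∑ y : Perm α, |(lazyCayleyP S ^ t) x y - 1 / (Fintype.card (Perm α) : ℝ)|) =
      ∑ g, |mu S t g - 1 / (Fintype.card (Perm α) : ℝ)| := by
    intro x
    simp only [lazy_pow S h1, comb_apply]
    exact Equiv.sum_comp (Equiv.mulLeft x⁻¹)
      (fun g => |mu S t g - 1 / (Fintype.card (Perm α) : ℝ)|)
  simp only [this]
  constructor
  · intro h; linarith [h 1]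
  · intro h _; linarith

lemma avg_univ : avg (rr : Perm α →* _) univ = ∑ g, (1 / (Fintype.card (Perm α) : ℝ)) • rr g := by
  have : symOn (univ : Finset α) = univ := by ext g; simp [mem_symOn]
  rw [avg, this, ← Finset.smul_sum, Finset.card_univ, one_div]

lemma norm_pow_sub_avg (S : Finset (Perm α)) (t : ℕ) :
    ∑ g, |mu S t g - 1 / (Fintype.card (Perm α) : ℝ)| ≤
      ‖lazyElt rr S ^ t - avg (rr : Perm α →* _) univ‖ := by
  rw [lazyElt_pow, avg_univ, ← Finset.sum_sub_distrib]
  simp only [← sub_smul]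
  exact comb_norm_ge _

/-- positivity of the law -/
lemma mu_pos_mono (S : Finset (Perm α)) (g : Perm α) (t k : ℕ) (h : 0 < mu S t g) :
    0 < mu S (t + k) g := by
  induction k with
  | zero => exact h
  | succ k ih =>
    rw [← add_assoc, mu]
    have : 0 ≤ ∑ s ∈ S, mu S (t + k) (g * s⁻¹) := Finset.sum_nonneg fun s _ => mu_nonneg S _ _
    positivity

lemma mu_pos (S : Finset (Perm α)) (hS : IsSymmGen S) (g : Perm α) : ∃ t, 0 < mu S t g := by
  obtain ⟨h1, hinv, hcl⟩ := hS
  have hg : g ∈ Subgroup.closure (S : Set (Perm α)) := by rw [hcl]; trivial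
  have step : ∀ (x : Perm α) (s : Perm α), s ∈ S → (∃ t, 0 < mu S t x) → ∃ t, 0 < mu S t (x * s) := by
    rintro x s hs ⟨t, ht⟩
    refine ⟨t + 1, ?_⟩
    rw [mu]
    have hp : 0 < ∑ s' ∈ S, mu S t (x * s * s'⁻¹) := by
      refine Finset.sum_pos' (fun s' _ => mu_nonneg S _ _) ⟨s, hs, ?_⟩
      simpa using ht
    have hc : (0 : ℝ) < S.card := by exact_mod_cast Finset.card_pos.2 ⟨s, hs⟩
    have := mu_nonneg S t (x * s)
    positivity
  refine Subgroup.closure_induction_right (p := fun g _ => ∃ t, 0 < mu S t g) ?_ ?_ ?_ hg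
  · exact ⟨0, by simp [mu]⟩
  · intro x _ y hy h
    exact step x y hy h
  · intro x _ y hy h
    exact step x y⁻¹ (hinv y hy) h

lemma mu_pos_all (S : Finset (Perm α)) (hS : IsSymmGen S) : ∃ t, ∀ g, 0 < mu S t g := by
  choose T hT using mu_pos S hS
  refine ⟨univ.sup T, fun g => ?_⟩
  obtain ⟨k, hk⟩ := Nat.exists_eq_add_of_le (Finset.le_sup (f := T) (Finset.mem_univ g))
  rw [hk]
  exact mu_pos_mono S g _ _ (hT g)

lemma lazyElt_avg {A : Type*} [NormedRing A] [NormedAlgebra ℝ A] (R : Perm α →* A)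
    (m : Perm α → ℝ) : (∑ g, m g • R g) * avg R univ = (∑ g, m g) • avg R univ := by
  rw [Finset.sum_mul, Finset.sum_smul]
  refine Finset.sum_congr rfl fun g _ => ?_
  rw [smul_mul_assoc, mul_avg]
  simp [mem_symOn]

lemma avg_lazyElt {A : Type*} [NormedRing A] [NormedAlgebra ℝ A] (R : Perm α →* A)
    (m : Perm α → ℝ) : avg R univ * (∑ g, m g • R g) = (∑ g, m g) • avg R univ := by
  rw [Finset.mul_sum, Finset.sum_smul]
  refine Finset.sum_congr rfl fun g _ => ?_
  rw [mul_smul_comm, avg_mul]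
  simp [mem_symOn]

/-- the walk converges, so the mixing set is nonempty -/
lemma mix_nonempty (S : Finset (Perm α)) (hne : S.Nonempty) (hS : IsSymmGen S) :
    ∃ t, ∑ g, |mu S t g - 1 / (Fintype.card (Perm α) : ℝ)| ≤ 1 / 2 := by
  obtain ⟨m, hm⟩ := mu_pos_all S hS
  obtain ⟨g0, -, hg0⟩ := Finset.exists_min_image univ (mu S m) Finset.univ_nonempty
  set ε := mu S m g0 with hε
  have hεp : 0 < ε := hm g0
  set n : ℝ := (Fintype.card (Perm α) : ℝ) with hn
  have hnp : 0 < n := by rw [hn]; exact_mod_cast Fintype.card_pos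
  set a := n * ε with ha
  set E : Matrix (Perm α) (Perm α) ℝ := avg (rr : Perm α →* _) univ with hE
  set Y : Matrix (Perm α) (Perm α) ℝ := ∑ g, (mu S m g - ε) • rr g with hY
  have hsum : ∑ g, (mu S m g - ε) = 1 - a := by
    rw [Finset.sum_sub_distrib, mu_sum_one S hne]; simp [ha, hn]
  have hYn : ‖Y‖ ≤ 1 - a := by
    refine (comb_norm _).trans ?_
    rw [← hsum]
    exact Finset.sum_le_sum fun g _ => by
      rw [abs_of_nonneg (sub_nonneg.2 (hg0 g (Finset.mem_univ _)))]
  have ha1 : 0 ≤ 1 - a := (norm_nonneg _).trans hYn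
  have ha0 : 0 < a := by positivity
  have hX : lazyElt rr S ^ m = Y + a • E := by
    rw [lazyElt_pow, hY, hE, avg_univ]
    rw [Finset.smul_sum, ← Finset.sum_add_distrib]
    refine Finset.sum_congr rfl fun g _ => ?_
    rw [smul_smul, ← add_smul]
    congr 1
    rw [ha]; field_simp; ring
  have hYE : Y * E = (1 - a) • E := by rw [hY, hE, lazyElt_avg, hsum]
  have hEY : E * Y = (1 - a) • E := by rw [hY, hE, avg_lazyElt, hsum]
  have hEE : E * E = E := avg_mul_avg _ le_rfl
  have hYkE : ∀ k, Y ^ k * E = (1 - a) ^ k • E := by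
    intro k
    induction k with
    | zero => simp
    | succ k ih => rw [pow_succ', mul_assoc, ih, mul_smul_comm, hYE, smul_smul, pow_succ]
  have hpow : ∀ k, (lazyElt rr S ^ m) ^ k = Y ^ k + (1 - (1 - a) ^ k) • E := by
    intro k
    induction k with
    | zero => simp
    | succ k ih =>
      rw [pow_succ, ih, hX, add_mul, mul_add, mul_add, mul_smul_comm, hYkE, smul_mul_assoc, hEY,
        smul_mul_assoc, mul_smul_comm, hEE, pow_succ]
      module
  have hEn : ‖E‖ ≤ 1 := avg_norm _ rr_norm _
  have hbd : ∀ k, ∑ g, |mu S (m * k) g - 1 / n| ≤ 2 * (1 - a) ^ k := by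
    intro k
    refine (norm_pow_sub_avg S (m * k)).trans ?_
    rw [pow_mul, hpow]
    have : Y ^ k + (1 - (1 - a) ^ k) • E - E = Y ^ k - (1 - a) ^ k • E := by module
    rw [← hE, this]
    refine (norm_sub_le _ _).trans ?_
    have h1 : ‖Y ^ k‖ ≤ (1 - a) ^ k := (norm_pow_le _ _).trans (by gcongr)
    have h2 : ‖(1 - a) ^ k • E‖ ≤ (1 - a) ^ k := by
      rw [norm_smul, Real.norm_eq_abs, abs_of_nonneg (by positivity)]
      exact mul_le_of_le_one_right (by positivity) hEn
    linarith
  obtain ⟨k, hk⟩ := exists_pow_lt_of_lt_one (show (0 : ℝ) < 1 / 4 by norm_num)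
    (show 1 - a < 1 by linarith)
  exact ⟨m * k, (hbd k).trans (by linarith)⟩

end matrixPart

set_option linter.unusedSectionVars false
set_option linter.unusedVariables false

section mixBounds
open Equiv
open scoped Matrix.Norms.Operator

variable {α : Type*} [Fintype α] [DecidableEq α]

/-- indicator of a finite set -/
noncomputable def indF (U : Finset α) (x : α) : ℝ := if x ∈ U then 1 else 0

lemma union_bd (m : Perm α → ℝ) (hm : ∀ g, 0 ≤ m g) (Q : Finset α) (D : Finset (Perm α))
    (hD : ∀ g, g ∈ D ↔ ∀ x, x ∉ Q → g x ∈ Q) :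
    ∑ g ∈ Dᶜ, m g ≤ ∑ x ∈ Qᶜ, ∑ g, m g * indF Qᶜ (g x) := by
  rw [Finset.sum_comm]
  have h0 : ∀ g, 0 ≤ ∑ x ∈ Qᶜ, m g * indF Qᶜ (g x) := by
    intro g
    refine Finset.sum_nonneg fun x _ => mul_nonneg (hm g) ?_
    unfold indF; split_ifs <;> norm_num
  calc ∑ g ∈ Dᶜ, m g ≤ ∑ g ∈ Dᶜ, ∑ x ∈ Qᶜ, m g * indF Qᶜ (g x) := by
        refine Finset.sum_le_sum fun g hg => ?_
        rw [Finset.mem_compl, hD] at hg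
        push Not at hg
        obtain ⟨x, hx, hgx⟩ := hg
        have h1 : m g * indF Qᶜ (g x) = m g := by simp [indF, hgx]
        refine h1.symm.le.trans ?_
        refine Finset.single_le_sum (f := fun x => m g * indF Qᶜ (g x)) (s := Qᶜ) ?_ (by simpa using hx)
        intro y _
        refine mul_nonneg (hm g) ?_
        unfold indF; split_ifs <;> norm_num
    _ ≤ _ := Finset.sum_le_sum_of_subset_of_nonneg (Finset.subset_univ _) fun g _ _ => h0 g

lemma unif_ind [Nonempty α] (U : Finset α) (x : α) :
    ∑ g : Perm α, (1 / (Fintype.card (Perm α) : ℝ)) * indF U (g x) =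
      (U.card : ℝ) / Fintype.card α := by
  have h := unif_part (indF U) x
  have h2 : ∑ y, indF U y = U.card := by simp [indF]
  rw [h2] at h
  have hn : (0 : ℝ) < Fintype.card α := by exact_mod_cast Fintype.card_pos
  have hp : (0 : ℝ) < Fintype.card (Perm α) := by exact_mod_cast Fintype.card_pos
  rw [← Finset.mul_sum]
  field_simp
  linarith

lemma avg_mul_avg' {A : Type*} [NormedRing A] [NormedAlgebra ℝ A] (R : Perm α →* A)
    (Q : Finset α) : avg R univ * avg R Q = avg R univ := by
  conv_lhs => rw [avg.eq_1 R Q]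
  rw [mul_smul_comm, Finset.mul_sum]
  rw [Finset.sum_congr rfl fun g _ => avg_mul R (B := univ) (h := g) (by simp [mem_symOn]),
    Finset.sum_const, ← Nat.cast_smul_eq_nsmul ℝ, smul_smul,
    inv_mul_cancel₀ (symOn_card_pos Q).ne', one_smul]

theorem upper_mix [Nonempty α] (Adj : α → α → Prop) [DecidableRel Adj] (hs : ∀ a b, Adj a b → Adj b a)
    (hi : ∀ a, ¬ Adj a a) (Q : Finset α) (hcl : ∀ a ∈ Q, ∀ b ∈ Q, a ≠ b → Adj a b)
    (hQ : 5 ≤ Q.card) (t1 t : ℕ)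
    (h1 : 2 * (Q.card : ℝ) * Q.card * (1 - 1 / (4 * (Q.card : ℝ))) ^ t1 +
      t1 * (((gens Adj \ swapsIn Q).card : ℝ) / (gens Adj).card) ≤ 1 / 8)
    (h2 : ∑ x ∈ Qᶜ, Fpart (gens Adj) (indF Qᶜ) t x + (Qᶜ.card : ℝ) ^ 2 / Fintype.card α ≤ 1 / 8) :
    tvMixUnif (lazyCayleyP (gens Adj)) ≤ 2 * t1 + t := by
  set S := gens Adj with hS
  have hsub : swapsIn Q ⊆ S := by
    intro s h
    obtain ⟨a, b, ha, hb, hab, rfl⟩ := mem_swapsIn.1 h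
    exact mem_gens.2 ⟨a, b, hcl a ha b hb hab, rfl⟩
  have hne0 : (swapsIn Q).Nonempty := by
    rw [← Finset.card_pos]
    have := swapsIn_card_ge Q 2 (by omega)
    omega
  have hne : S.Nonempty := hne0.mono hsub
  have hone : (1 : Perm α) ∉ S := by
    intro h
    obtain ⟨a, b, hab, h⟩ := mem_gens.1 h
    have : a = b := by
      have := congrArg (fun s : Perm α => s a) h
      simpa using this
    subst this; exact hi _ hab
  apply Nat.sInf_le
  rw [Set.mem_ofPred_eq, mixset_iff S hone]
  refine (norm_pow_sub_avg S _).trans ?_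
  set P : Matrix (Perm α) (Perm α) ℝ := lazyElt rr S with hP
  set T : Matrix (Perm α) (Perm α) ℝ := lazyElt rr (swapsIn Q) with hT
  set f : Matrix (Perm α) (Perm α) ℝ := avg rr Q with hf
  set E : Matrix (Perm α) (Perm α) ℝ := avg rr univ with hE
  have hPn : ‖P‖ ≤ 1 := lazyElt_norm _ rr_norm _
  have hTn : ‖T‖ ≤ 1 := lazyElt_norm _ rr_norm _
  have hfn : ‖f‖ ≤ 1 := avg_norm _ rr_norm _
  have hPf : ‖P ^ t1 - f‖ ≤ 1 / 8 := by
    have e1 := pow_sub_pow_norm hPn hTn t1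
    have e2 := lazyElt_sub_norm (rr : Perm α →* _) rr_norm hsub hne0
    have e3 := hubmix (rr : Perm α →* _) rr_norm Q hQ t1 ∅ (Finset.empty_subset _)
    rw [avg_empty, one_mul] at e3
    have e4 : ‖P ^ t1 - f‖ ≤ ‖P ^ t1 - T ^ t1‖ + ‖T ^ t1 - f‖ := by
      have : P ^ t1 - f = (P ^ t1 - T ^ t1) + (T ^ t1 - f) := by abel
      rw [this]; exact norm_add_le _ _
    have e5 : (t1 : ℝ) * ‖P - T‖ ≤ t1 * (((S \ swapsIn Q).card : ℝ) / S.card) := by gcongr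
    simp only [Finset.card_empty, Nat.cast_zero, sub_zero, zero_add, div_one] at e3
    linarith
  have hPtn : ∀ k, ‖P ^ k‖ ≤ 1 := fun k => (norm_pow_le _ _).trans (pow_le_one₀ (norm_nonneg _) hPn)
  have hfE : f * E * f = E := by
    rw [hf, hE, avg_mul_avg _ (Finset.subset_univ _), avg_mul_avg']
  have hcore : ‖f * P ^ t * f - E‖ ≤ 1 / 4 := by
    set D := univ.filter (fun g : Perm α => ∀ x, x ∉ Q → g x ∈ Q) with hDdef
    have hD : ∀ g, g ∈ D ↔ ∀ x, x ∉ Q → g x ∈ Q := by intro g; simp [hDdef]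
    have hpos : (0 : ℝ) < Fintype.card (Perm α) := by exact_mod_cast Fintype.card_pos
    have hc := mixCore (rr : Perm α →* _) rr_norm Q (mu S t)
      (fun _ => 1 / (Fintype.card (Perm α) : ℝ)) (mu_nonneg S t) (fun _ => by positivity)
      (mu_sum_one S hne t) (by simp) D hD
    rw [← lazyElt_pow, ← avg_univ, ← hP, ← hf, ← hE, hfE] at hc
    refine hc.trans ?_
    have u1 := union_bd (mu S t) (mu_nonneg S t) Q D hD
    have u2 := union_bd (fun _ => 1 / (Fintype.card (Perm α) : ℝ)) (fun _ => by positivity) Q D hD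
    simp only [unif_ind, Finset.sum_const, nsmul_eq_mul] at u2
    simp only [Finset.sum_const, nsmul_eq_mul] 
    have e : ((Qᶜ.card : ℕ) : ℝ) * ((Qᶜ.card : ℝ) / Fintype.card α) =
      (Qᶜ.card : ℝ) ^ 2 / Fintype.card α := by ring
    rw [e] at u2
    unfold Fpart at h2
    linarith
  have dec : P ^ (2 * t1 + t) - E = (P ^ t1 - f) * (P ^ t * P ^ t1) + f * P ^ t * (P ^ t1 - f)
      + (f * P ^ t * f - E) := by
    have : P ^ (2 * t1 + t) = P ^ t1 * (P ^ t * P ^ t1) := by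
      rw [← pow_add, ← pow_add]; congr 1; ring
    rw [this]; noncomm_ring
  rw [dec]
  have n1 : ‖(P ^ t1 - f) * (P ^ t * P ^ t1)‖ ≤ 1 / 8 := by
    rw [← pow_add]
    refine (norm_mul_le _ _).trans ?_
    calc _ ≤ ‖P ^ t1 - f‖ * 1 := by gcongr; exact hPtn _
      _ ≤ _ := by linarith
  have n2 : ‖f * P ^ t * (P ^ t1 - f)‖ ≤ 1 / 8 := by
    refine (norm_mul_le _ _).trans ?_
    have : ‖f * P ^ t‖ ≤ 1 := (norm_mul_le _ _).trans (mul_le_one₀ hfn (norm_nonneg _) (hPtn _))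
    calc _ ≤ 1 * ‖P ^ t1 - f‖ := by gcongr
      _ ≤ _ := by linarith
  refine (norm_add_le _ _).trans ?_
  have := norm_add_le ((P ^ t1 - f) * (P ^ t * P ^ t1)) (f * P ^ t * (P ^ t1 - f))
  linarith

theorem lower_mix [Nonempty α] (S : Finset (Perm α)) (hne : S.Nonempty) (hS : IsSymmGen S)
    (U : Finset α) (x : α) (T : ℕ)
    (h : ∀ t < T, 1 / 2 + (U.card : ℝ) / Fintype.card α < Fpart S (indF U) t x) :
    T ≤ tvMixUnif (lazyCayleyP S) := by
  apply le_csInf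
  · obtain ⟨t, ht⟩ := mix_nonempty S hne hS
    exact ⟨t, (mixset_iff S hS.1 t).2 ht⟩
  · intro t ht
    rw [Set.mem_ofPred_eq, mixset_iff S hS.1] at ht
    by_contra hlt
    have h1 := h t (by omega)
    rw [Fpart, ← unif_ind U x] at h1
    have h2 : ∑ g, mu S t g * indF U (g x) - ∑ g : Perm α, 1 / (Fintype.card (Perm α) : ℝ) * indF U (g x)
        ≤ ∑ g, |mu S t g - 1 / (Fintype.card (Perm α) : ℝ)| := by
      rw [← Finset.sum_sub_distrib]
      refine Finset.sum_le_sum fun g _ => ?_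
      rw [← sub_mul]
      unfold indF
      split_ifs
      · rw [mul_one]; exact le_abs_self _
      · rw [mul_zero]; exact abs_nonneg _
    linarith

end mixBounds

set_option linter.unusedSectionVars false
set_option linter.unusedVariables false

section graphPart

/-- depth of the trees of stage `j` -/
def dd (j : ℕ) : ℕ := 16 * 2 ^ j

/-- number of roots of stage `j` -/
def mm : ℕ → ℕ
  | 0 => 1
  | j + 1 => dd j * mm j * 4 ^ dd j

lemma dd_pos (j : ℕ) : 0 < dd j := by unfold dd; positivity

lemma dd_succ (j : ℕ) : dd (j + 1) = 2 * dd j := by unfold dd; ring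

lemma mm_pos (j : ℕ) : 0 < mm j := by
  induction j with
  | zero => simp [mm]
  | succ j ih => rw [mm]; have := dd_pos j; positivity

lemma mm_succ (j : ℕ) : mm (j + 1) = dd j * mm j * 4 ^ dd j := rfl

/-- raw tree vertices -/
abbrev HV := (_ : ℕ) × (_ : ℕ) × (ℕ × ℕ)

/-- raw vertices -/
abbrev WV := HV ⊕ ℕ

/-- tree vertices -/
def Hset (K : ℕ) : Finset HV :=
  (range K).sigma fun j => (range (dd j + 1)).sigma fun l => range (mm j * 4 ^ l) ×ˢ range (dd j)

/-- all vertices -/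
def VS (K N : ℕ) : Finset WV := (Hset K).disjSum (range N)

lemma mem_Hset {K : ℕ} {p : HV} : p ∈ Hset K ↔ p.1 < K ∧ p.2.1 ≤ dd p.1 ∧
    p.2.2.1 < mm p.1 * 4 ^ p.2.1 ∧ p.2.2.2 < dd p.1 := by
  simp [Hset]

/-- tree edge -/
def Tr (p p' : HV) : Prop := p'.1 = p.1 ∧ p'.2.1 = p.2.1 + 1 ∧ p'.2.2.1 / 4 = p.2.2.1

/-- extra edge -/
def Xr (p p' : HV) : Prop := p.2.1 = dd p.1 ∧ p'.1 = p.1 + 1 ∧ p'.2.1 = 0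

/-- tree to hub edge -/
def Ur (p : HV) (q : ℕ) : Prop := (p.2.1 = dd p.1 ∧ q < 2 * dd p.1) ∨ (p.2.1 = 0 ∧ q = 0)

/-- adjacency -/
def AdjW (b : Prop) : WV → WV → Prop
  | Sum.inl p, Sum.inl p' => (Tr p p' ∨ Tr p' p) ∨ (b ∧ (Xr p p' ∨ Xr p' p))
  | Sum.inl p, Sum.inr q => Ur p q
  | Sum.inr q, Sum.inl p => Ur p q
  | Sum.inr q, Sum.inr q' => q ≠ q'

lemma AdjW_symm (b : Prop) (x y : WV) (h : AdjW b x y) : AdjW b y x := by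
  rcases x with p | q <;> rcases y with p' | q' <;> simp only [AdjW] at * <;> tauto

lemma AdjW_irrefl (b : Prop) (x : WV) : ¬ AdjW b x x := by
  rcases x with p | q <;> simp [AdjW, Tr, Xr]

open Classical in
/-- raw Laplacian -/
noncomputable def lapW (K N : ℕ) (b : Prop) (w : WV → ℝ) (x : WV) : ℝ :=
  ∑ y ∈ VS K N, if AdjW b x y then w y - w x else 0

lemma sum_H (K : ℕ) (g : HV → ℝ) : ∑ p ∈ Hset K, g p =
    ∑ j ∈ range K, ∑ l ∈ range (dd j + 1), ∑ i ∈ range (mm j * 4 ^ l), ∑ s ∈ range (dd j),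
      g ⟨j, l, (i, s)⟩ := by
  rw [Hset, Finset.sum_sigma]
  refine Finset.sum_congr rfl fun j _ => ?_
  rw [Finset.sum_sigma]
  refine Finset.sum_congr rfl fun l _ => ?_
  rw [Finset.sum_product]

lemma sum_H_class (K : ℕ) (φ : ℕ → ℕ → ℝ) : ∑ p ∈ Hset K, φ p.1 p.2.1 =
    ∑ j ∈ range K, ∑ l ∈ range (dd j + 1), ((mm j : ℝ) * 4 ^ l) * dd j * φ j l := by
  rw [sum_H]
  refine Finset.sum_congr rfl fun j _ => Finset.sum_congr rfl fun l _ => ?_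
  simp; ring

/-- sum over a single class -/
lemma sum_one_class (K : ℕ) (j l : ℕ) (hj : j < K) (hl : l ≤ dd j) (P : ℕ → Prop) [DecidablePred P]
    (g : HV → ℝ) (c : ℝ)
    (h0 : ∀ p ∈ Hset K, ¬ (p.1 = j ∧ p.2.1 = l ∧ P p.2.2.1) → g p = 0)
    (h1 : ∀ p ∈ Hset K, (p.1 = j ∧ p.2.1 = l ∧ P p.2.2.1) → g p = c) :
    ∑ p ∈ Hset K, g p = (((range (mm j * 4 ^ l)).filter P).card : ℝ) * dd j * c := by
  rw [sum_H, Finset.sum_eq_single j, Finset.sum_eq_single l]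
  · have : ∀ i ∈ range (mm j * 4 ^ l), ∑ s ∈ range (dd j), g ⟨j, l, (i, s)⟩ =
        if P i then (dd j : ℝ) * c else 0 := by
      intro i hi
      split_ifs with hP
      · rw [Finset.sum_congr rfl fun s hs => h1 ⟨j, l, (i, s)⟩ ?_ ?_]
        · simp
        · rw [mem_Hset]; simp at hi hs; exact ⟨hj, hl, hi, hs⟩
        · exact ⟨rfl, rfl, hP⟩
      · refine Finset.sum_eq_zero fun s hs => h0 _ ?_ ?_
        · rw [mem_Hset]; simp at hi hs; exact ⟨hj, hl, hi, hs⟩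
        · exact fun h => hP h.2.2
    rw [Finset.sum_congr rfl this, ← Finset.sum_filter, Finset.sum_const, nsmul_eq_mul]; ring
  · intro l' hl' hne
    refine Finset.sum_eq_zero fun i hi => Finset.sum_eq_zero fun s hs => h0 _ ?_ ?_
    · rw [mem_Hset]; simp at hl' hi hs; exact ⟨hj, by simpa [Nat.lt_succ_iff] using hl', hi, hs⟩
    · exact fun h => hne h.2.1
  · intro h; exact absurd (Finset.mem_range.2 (by omega)) h
  · intro j' hj' hne
    refine Finset.sum_eq_zero fun l' hl' => Finset.sum_eq_zero fun i hi =>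
      Finset.sum_eq_zero fun s hs => h0 _ ?_ ?_
    · rw [mem_Hset]; simp at hj' hl' hi hs
      exact ⟨hj', by simpa [Nat.lt_succ_iff] using hl', hi, hs⟩
    · exact fun h => hne h.1
  · intro h; exact absurd (Finset.mem_range.2 hj) h

lemma card_div4 (M i : ℕ) (hi : i < M) : ((range (M * 4)).filter (fun k => k / 4 = i)).card = 4 := by
  have : (range (M * 4)).filter (fun k => k / 4 = i) = Finset.Ico (4 * i) (4 * i + 4) := by
    ext k
    simp only [Finset.mem_filter, Finset.mem_range, Finset.mem_Ico]
    omega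
  rw [this]; simp

open Classical in
lemma sum_Tr (K : ℕ) (p : HV) (hp : p ∈ Hset K) (φ : ℕ → ℕ → ℝ) (c : ℝ) :
    ∑ p' ∈ Hset K, (if Tr p p' then φ p'.1 p'.2.1 - c else 0) =
      if p.2.1 < dd p.1 then 4 * dd p.1 * (φ p.1 (p.2.1 + 1) - c) else 0 := by
  rw [mem_Hset] at hp
  split_ifs with h
  · rw [sum_one_class K p.1 (p.2.1 + 1) hp.1 h (fun k => k / 4 = p.2.2.1) _
      (φ p.1 (p.2.1 + 1) - c)]
    · rw [pow_succ, ← mul_assoc, card_div4 _ _ hp.2.2.1]; push_cast; ring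
    · intro p' _ h'; rw [if_neg]; exact h'
    · intro p' _ h'; rw [if_pos (show Tr p p' from h'), h'.1, h'.2.1]
  · refine Finset.sum_eq_zero fun p' hp' => ?_
    rw [if_neg]
    rintro ⟨h1, h2, -⟩
    rw [mem_Hset, h1, h2] at hp'
    omega

open Classical in
lemma sum_Tr' (K : ℕ) (p : HV) (hp : p ∈ Hset K) (φ : ℕ → ℕ → ℝ) (c : ℝ) :
    ∑ p' ∈ Hset K, (if Tr p' p then φ p'.1 p'.2.1 - c else 0) =
      if 0 < p.2.1 then dd p.1 * (φ p.1 (p.2.1 - 1) - c) else 0 := by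
  rw [mem_Hset] at hp
  split_ifs with h
  · rw [sum_one_class K p.1 (p.2.1 - 1) hp.1 (by omega) (fun k => k = p.2.2.1 / 4) _
      (φ p.1 (p.2.1 - 1) - c)]
    · have hlt : p.2.2.1 / 4 < mm p.1 * 4 ^ (p.2.1 - 1) := by
        rw [Nat.div_lt_iff_lt_mul (by norm_num), mul_assoc, ← pow_succ, Nat.sub_add_cancel h]
        exact hp.2.2.1
      have : (range (mm p.1 * 4 ^ (p.2.1 - 1))).filter (fun k => k = p.2.2.1 / 4) = {p.2.2.1 / 4} := by
        ext k
        simp only [Finset.mem_filter, Finset.mem_range, Finset.mem_singleton]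
        constructor
        · exact fun h => h.2
        · rintro rfl; exact ⟨hlt, rfl⟩
      rw [this]; simp
    · intro p' _ h'; rw [if_neg]
      rintro ⟨h1, h2, h3⟩
      exact h' ⟨h1.symm, by omega, h3.symm⟩
    · intro p' _ h'; rw [if_pos, h'.1, h'.2.1]
      exact ⟨h'.1.symm, by omega, h'.2.2.symm⟩
  · refine Finset.sum_eq_zero fun p' hp' => ?_
    rw [if_neg]
    rintro ⟨h1, h2, -⟩
    omega

open Classical in
lemma sum_Xr (K : ℕ) (p : HV) (hp : p ∈ Hset K) (φ : ℕ → ℕ → ℝ) (c : ℝ) :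
    ∑ p' ∈ Hset K, (if Xr p p' then φ p'.1 p'.2.1 - c else 0) =
      if p.2.1 = dd p.1 ∧ p.1 + 1 < K then mm (p.1 + 1) * dd (p.1 + 1) * (φ (p.1 + 1) 0 - c)
        else 0 := by
  split_ifs with h
  · rw [sum_one_class K (p.1 + 1) 0 h.2 (Nat.zero_le _) (fun _ => True) _ (φ (p.1 + 1) 0 - c)]
    · simp
    · intro p' _ h'; rw [if_neg]
      rintro ⟨h1, h2, h3⟩
      exact h' ⟨h2, h3, trivial⟩
    · intro p' _ h'; rw [if_pos, h'.1, h'.2.1]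
      exact ⟨h.1, h'.1, h'.2.1⟩
  · refine Finset.sum_eq_zero fun p' hp' => ?_
    rw [if_neg]
    rintro ⟨h1, h2, h3⟩
    rw [mem_Hset, h2] at hp'
    exact h ⟨h1, hp'.1⟩

open Classical in
lemma sum_Xr' (K : ℕ) (p : HV) (hp : p ∈ Hset K) (φ : ℕ → ℕ → ℝ) (c : ℝ) :
    ∑ p' ∈ Hset K, (if Xr p' p then φ p'.1 p'.2.1 - c else 0) =
      if p.2.1 = 0 ∧ 0 < p.1 then mm p.1 * (φ (p.1 - 1) (dd (p.1 - 1)) - c) else 0 := by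
  rw [mem_Hset] at hp
  split_ifs with h
  · rw [sum_one_class K (p.1 - 1) (dd (p.1 - 1)) (by omega) le_rfl (fun _ => True) _
      (φ (p.1 - 1) (dd (p.1 - 1)) - c)]
    · have := mm_succ (p.1 - 1)
      rw [Nat.sub_add_cancel h.2] at this
      rw [this]; simp; left; ring
    · intro p' _ h'; rw [if_neg]
      rintro ⟨h1, h2, h3⟩
      have : p'.1 = p.1 - 1 := by omega
      exact h' ⟨this, by rw [h1, this], trivial⟩
    · intro p' _ h'; rw [if_pos, h'.1, h'.2.1]
      exact ⟨by rw [h'.2.1, h'.1], by omega, h.1⟩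
  · refine Finset.sum_eq_zero fun p' hp' => ?_
    rw [if_neg]
    rintro ⟨h1, h2, h3⟩
    exact h ⟨h3, by omega⟩

/-- function on vertices from class data -/
def mkW (φ : ℕ → ℕ → ℝ) (ψ : ℕ → ℝ) : WV → ℝ
  | Sum.inl p => φ p.1 p.2.1
  | Sum.inr q => ψ q

lemma VS_sum (K N : ℕ) (g : WV → ℝ) :
    ∑ y ∈ VS K N, g y = ∑ p ∈ Hset K, g (Sum.inl p) + ∑ q ∈ range N, g (Sum.inr q) := by
  rw [VS, Finset.sum_disjSum]

open Classical in
lemma sum_Ur (N R : ℕ) (p : HV) (hR : 2 * dd p.1 ≤ R) (hN : R ≤ N) (ψ : ℕ → ℝ) (c0 c : ℝ)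
    (hψ : ∀ q < R, ψ q = c0) :
    ∑ q ∈ range N, (if Ur p q then ψ q - c else 0) =
      (if p.2.1 = dd p.1 then 2 * dd p.1 * (c0 - c) else 0) + if p.2.1 = 0 then c0 - c else 0 := by
  have hd := dd_pos p.1
  by_cases h0 : p.2.1 = 0
  · have hne : ¬ p.2.1 = dd p.1 := by omega
    rw [if_neg hne, if_pos h0, zero_add, Finset.sum_eq_single 0]
    · rw [if_pos, hψ 0 (by omega)]
      exact Or.inr ⟨h0, rfl⟩
    · intro q _ hq
      rw [if_neg]
      rintro (h | h)
      · exact hne h.1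
      · exact hq h.2
    · intro h; simp at h; omega
  · rw [if_neg h0, add_zero]
    split_ifs with h1
    · have hsub : range (2 * dd p.1) ⊆ range N := by
        intro q hq; simp at *; omega
      rw [← Finset.sum_subset hsub]
      · rw [Finset.sum_congr rfl (g := fun _ => c0 - c)]
        · simp; ring
        · intro q hq
          rw [Finset.mem_range] at hq
          rw [if_pos (show Ur p q from Or.inl ⟨h1, hq⟩), hψ q (by omega)]
      · intro q _ hq
        rw [Finset.mem_range] at hq
        rw [if_neg]
        rintro (h | h)
        · exact hq h.2
        · exact h0 h.1
    · refine Finset.sum_eq_zero fun q _ => ?_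
      rw [if_neg]
      rintro (h | h)
      · exact h1 h.1
      · exact h0 h.1

open Classical in
lemma lapW_H (K N R : ℕ) (b : Prop) (φ : ℕ → ℕ → ℝ) (ψ : ℕ → ℝ) (c0 : ℝ) (hψ : ∀ q < R, ψ q = c0)
    (hN : R ≤ N) (p : HV) (hp : p ∈ Hset K) (hR : 2 * dd p.1 ≤ R) :
    lapW K N b (mkW φ ψ) (Sum.inl p) =
      (if p.2.1 < dd p.1 then 4 * dd p.1 * (φ p.1 (p.2.1 + 1) - φ p.1 p.2.1) else 0) +
      (if 0 < p.2.1 then dd p.1 * (φ p.1 (p.2.1 - 1) - φ p.1 p.2.1) else 0) +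
      (if b then
        (if p.2.1 = dd p.1 ∧ p.1 + 1 < K then
          mm (p.1 + 1) * dd (p.1 + 1) * (φ (p.1 + 1) 0 - φ p.1 p.2.1) else 0) +
        (if p.2.1 = 0 ∧ 0 < p.1 then mm p.1 * (φ (p.1 - 1) (dd (p.1 - 1)) - φ p.1 p.2.1) else 0)
        else 0) +
      ((if p.2.1 = dd p.1 then 2 * dd p.1 * (c0 - φ p.1 p.2.1) else 0) +
        if p.2.1 = 0 then c0 - φ p.1 p.2.1 else 0) := by
  rw [lapW, VS_sum]
  have hub : ∑ q ∈ range N, (if AdjW b (Sum.inl p) (Sum.inr q) then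
      mkW φ ψ (Sum.inr q) - mkW φ ψ (Sum.inl p) else 0) =
      ∑ q ∈ range N, (if Ur p q then ψ q - φ p.1 p.2.1 else 0) :=
    Finset.sum_congr rfl fun q _ => if_congr Iff.rfl rfl rfl
  rw [hub, sum_Ur N R p hR hN ψ c0 _ hψ]
  congr 1
  rw [← sum_Tr K p hp φ, ← sum_Tr' K p hp φ, ← sum_Xr K p hp φ, ← sum_Xr' K p hp φ]
  have key : ∀ p' : HV, ∀ v : ℝ, (if AdjW b (Sum.inl p) (Sum.inl p') then v else 0) =
      (if Tr p p' then v else 0) + (if Tr p' p then v else 0) +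
      if b then (if Xr p p' then v else 0) + (if Xr p' p then v else 0) else 0 := by
    intro p' v
    rw [if_congr (show AdjW b (Sum.inl p) (Sum.inl p') ↔
      (Tr p p' ∨ Tr p' p) ∨ (b ∧ (Xr p p' ∨ Xr p' p)) from Iff.rfl) rfl rfl]
    have a1 : Tr p p' → ¬ Tr p' p := by rintro ⟨_, h, _⟩ ⟨_, h', _⟩; omega
    have a2 : Tr p p' → ¬ Xr p p' := by rintro ⟨h, _, _⟩ ⟨_, h', _⟩; omega
    have a3 : Tr p p' → ¬ Xr p' p := by rintro ⟨h, _, _⟩ ⟨_, h', _⟩; omega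
    have a4 : Tr p' p → ¬ Xr p p' := by rintro ⟨h, _, _⟩ ⟨_, h', _⟩; omega
    have a5 : Tr p' p → ¬ Xr p' p := by rintro ⟨h, _, _⟩ ⟨_, h', _⟩; omega
    have a6 : Xr p p' → ¬ Xr p' p := by rintro ⟨_, h, _⟩ ⟨_, h', _⟩; omega
    by_cases hb : b <;> by_cases t1 : Tr p p' <;> by_cases t2 : Tr p' p <;>
      by_cases t3 : Xr p p' <;> by_cases t4 : Xr p' p <;> simp_all
  rw [Finset.sum_congr rfl fun p' _ => key p' _, Finset.sum_add_distrib, Finset.sum_add_distrib]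
  simp only [mkW]
  congr 1
  split_ifs
  · rw [Finset.sum_add_distrib]
  · simp

end graphPart

set_option linter.unusedSectionVars false
set_option linter.unusedVariables false

section solutions

lemma dd_mono {i j : ℕ} (h : i ≤ j) : dd i ≤ dd j := by
  unfold dd; gcongr; norm_num

/-- supersolution on the trees -/
noncomputable def supφ (e β η : ℝ) (t : ℕ) (j l : ℕ) : ℝ :=
  2 ^ (dd j - l) * (1 - dd j / (2 * e)) ^ t + (β + η * t / (2 * e))

/-- supersolution on the hub -/
noncomputable def supψ (R : ℕ) (e β η : ℝ) (t : ℕ) (q : ℕ) : ℝ :=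
  (if q < R then β else 0) + η * t / (2 * e)

lemma super_H (K N : ℕ) (e β η : ℝ) (he : 0 < e) (hη : 0 ≤ η) (hN : dd K ≤ N)
    (hde : (dd K : ℝ) ≤ 2 * e) (t : ℕ) (p : HV) (hp : p ∈ Hset K) :
    mkW (supφ e β η t) (supψ (dd K) e β η t) (Sum.inl p) +
      1 / (2 * e) * lapW K N False (mkW (supφ e β η t) (supψ (dd K) e β η t)) (Sum.inl p) ≤
    mkW (supφ e β η (t + 1)) (supψ (dd K) e β η (t + 1)) (Sum.inl p) := by
  have hp' := mem_Hset.1 hp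
  have hR : 2 * dd p.1 ≤ dd K := by
    rw [← dd_succ]; exact dd_mono hp'.1
  rw [lapW_H K N (dd K) False _ _ (β + η * t / (2 * e)) (by intro q hq; simp [supψ, hq]) hN p hp hR]
  obtain ⟨j, l, i, s⟩ := p
  simp only [mkW, if_false, add_zero] at *
  set d : ℝ := (dd j : ℝ) with hd
  have hdpos : 0 < d := by rw [hd]; exact_mod_cast dd_pos j
  have hdK : d ≤ 2 * e := by
    refine le_trans ?_ hde
    rw [hd]; exact_mod_cast dd_mono hp'.1.le
  set ρ : ℝ := 1 - d / (2 * e) with hρ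
  have hρ0 : 0 ≤ ρ := by rw [hρ, sub_nonneg, div_le_one (by positivity)]; exact hdK
  set r := ρ ^ t with hr
  have hr0 : 0 ≤ r := by positivity
  set a : ℝ := 2 ^ (dd j - l) * r with ha
  have ha0 : 0 ≤ a := by positivity
  set B := β + η * t / (2 * e) with hB
  have eφ : supφ e β η t j l = a + B := rfl
  have eφ' : supφ e β η (t + 1) j l = a * ρ + B + η / (2 * e) := by
    simp only [supφ, pow_succ, ha, hr, hB, ← hρ, ← hd]; push_cast; ring
  have up : l < dd j → supφ e β η t j (l + 1) = a / 2 + B := by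
    intro h
    have : dd j - l = (dd j - (l + 1)) + 1 := by omega
    simp only [supφ, ha]
    rw [this, pow_succ]; simp only [← hd, ← hρ, ← hr, hB]; ring
  have down : 0 < l → supφ e β η t j (l - 1) = 2 * a + B := by
    intro h
    have : dd j - (l - 1) = (dd j - l) + 1 := by omega
    simp only [supφ, ha]
    rw [this, pow_succ]; simp only [← hd, ← hρ, ← hr, hB]; ring
  rw [eφ, eφ']
  have main : ∀ L : ℝ, L ≤ - d * a → a + B + 1 / (2 * e) * L ≤ a * ρ + B + η / (2 * e) := by
    intro L hL
    have h1 : 1 / (2 * e) * L ≤ 1 / (2 * e) * (- d * a) := by gcongr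
    have h2 : a * ρ = a + 1 / (2 * e) * (- d * a) := by rw [hρ]; ring
    have h3 : 0 ≤ η / (2 * e) := by positivity
    linarith
  apply main
  have hj := dd_pos j
  by_cases h0 : l = 0
  · have hlt : l < dd j := by omega
    rw [if_pos hlt, if_neg (by omega), if_neg (by omega), if_pos h0, up hlt]
    nlinarith [mul_nonneg hdpos.le ha0]
  · have hpos : 0 < l := by omega
    by_cases hl : l = dd j
    · rw [if_neg (by omega), if_pos hpos, if_pos hl, if_neg h0, down hpos]
      nlinarith [mul_nonneg hdpos.le ha0]
    · have hlt : l < dd j := by omega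
      rw [if_pos hlt, if_pos hpos, if_neg hl, if_neg h0, up hlt, down hpos]
      nlinarith [mul_nonneg hdpos.le ha0]

lemma super_hub (K N : ℕ) (e β η : ℝ) (he : 0 < e) (hN : dd K < N)
    (hde : (dd K : ℝ) ≤ 2 * e) (hβ : β = (Hset K).card * 2 ^ dd K / ((N : ℝ) - dd K))
    (hη : η = dd K * β) (t : ℕ) (q : ℕ) (hq : q < N) :
    mkW (supφ e β η t) (supψ (dd K) e β η t) (Sum.inr q) +
      1 / (2 * e) * lapW K N False (mkW (supφ e β η t) (supψ (dd K) e β η t)) (Sum.inr q) ≤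
    mkW (supφ e β η (t + 1)) (supψ (dd K) e β η (t + 1)) (Sum.inr q) := by
  classical
  have hNR : (0 : ℝ) < (N : ℝ) - dd K := by rw [sub_pos]; exact_mod_cast hN
  have hβ0 : 0 ≤ β := by rw [hβ]; positivity
  have hη0 : 0 ≤ η := by rw [hη]; positivity
  have hβN : ((N : ℝ) - dd K) * β = (Hset K).card * 2 ^ dd K := by rw [hβ]; field_simp
  suffices hL : lapW K N False (mkW (supφ e β η t) (supψ (dd K) e β η t)) (Sum.inr q) ≤ η by
    have h1 : 1 / (2 * e) * lapW K N False (mkW (supφ e β η t) (supψ (dd K) e β η t)) (Sum.inr q) ≤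
        1 / (2 * e) * η := by gcongr
    simp only [mkW, supψ] at *
    have h2 : η * ((t + 1 : ℕ) : ℝ) / (2 * e) = η * t / (2 * e) + 1 / (2 * e) * η := by push_cast; ring
    rw [h2]; linarith
  rw [lapW, VS_sum]
  set w := mkW (supφ e β η t) (supψ (dd K) e β η t) with hw
  have hcardR : ((range N).filter (fun q' => q' < dd K)).card = dd K := by
    have : (range N).filter (fun q' => q' < dd K) = range (dd K) := by
      ext k; simp; omega
    rw [this]; simp
  have hcardR' : (((range N).filter (fun q' => ¬ q' < dd K)).card : ℝ) = (N : ℝ) - dd K := by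
    have := Finset.card_filter_add_card_filter_not (s := range N) (fun q' => q' < dd K)
    rw [hcardR, Finset.card_range] at this
    rw [eq_sub_iff_add_eq]; rw [add_comm]; exact_mod_cast this
  by_cases hqR : q < dd K
  · have s1 : ∑ p ∈ Hset K, (if AdjW False (Sum.inr q) (Sum.inl p) then w (Sum.inl p) - w (Sum.inr q) else 0)
        ≤ ∑ p ∈ Hset K, (2 : ℝ) ^ dd K := by
      refine Finset.sum_le_sum fun p hp => ?_
      have hp' := mem_Hset.1 hp
      split_ifs
      · simp only [hw, mkW, supφ, supψ, if_pos hqR]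
        have hdK : (dd p.1 : ℝ) ≤ 2 * e := by
          refine le_trans ?_ hde
          exact_mod_cast dd_mono hp'.1.le
        have h1 : (1 - (dd p.1 : ℝ) / (2 * e)) ^ t ≤ 1 := by
          apply pow_le_one₀
          · rw [sub_nonneg, div_le_one (by positivity)]; exact hdK
          · have : 0 ≤ (dd p.1 : ℝ) / (2 * e) := by positivity
            linarith
        have h2 : (2 : ℝ) ^ (dd p.1 - p.2.1) ≤ 2 ^ dd K := by
          apply pow_le_pow_right₀ (by norm_num)
          have := dd_mono hp'.1.le
          omega
        have h3 : (2 : ℝ) ^ (dd p.1 - p.2.1) * (1 - (dd p.1 : ℝ) / (2 * e)) ^ t ≤ 2 ^ (dd p.1 - p.2.1) :=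
          mul_le_of_le_one_right (by positivity) h1
        linarith
      · positivity
    have s2 : ∑ q' ∈ range N, (if AdjW False (Sum.inr q) (Sum.inr q') then w (Sum.inr q') - w (Sum.inr q) else 0)
        ≤ ∑ q' ∈ range N, (if ¬ q' < dd K then -β else 0) := by
      refine Finset.sum_le_sum fun q' _ => ?_
      by_cases h : q' < dd K
      · simp [hw, mkW, supψ, hqR, h]
      · have : AdjW False (Sum.inr q) (Sum.inr q') := by
          show q ≠ q'
          omega
        simp [hw, mkW, supψ, hqR, h, this]
    have s3 : ∑ q' ∈ range N, (if ¬ q' < dd K then -β else 0) = ((N : ℝ) - dd K) * (-β) := by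
      rw [← Finset.sum_filter, Finset.sum_const, nsmul_eq_mul, hcardR']
    rw [s3] at s2
    rw [Finset.sum_const, nsmul_eq_mul] at s1
    linarith
  · have s1 : ∑ p ∈ Hset K, (if AdjW False (Sum.inr q) (Sum.inl p) then w (Sum.inl p) - w (Sum.inr q) else 0)
        = 0 := by
      refine Finset.sum_eq_zero fun p hp => ?_
      have hp' := mem_Hset.1 hp
      rw [if_neg]
      intro h
      have h' : Ur p q := h
      have h2 : dd (p.1 + 1) ≤ dd K := dd_mono hp'.1
      rw [dd_succ] at h2
      rcases h' with h' | h'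
      · omega
      · have := dd_pos K
        omega
    have s2 : ∑ q' ∈ range N, (if AdjW False (Sum.inr q) (Sum.inr q') then w (Sum.inr q') - w (Sum.inr q) else 0)
        ≤ ∑ q' ∈ range N, (if q' < dd K then β else 0) := by
      refine Finset.sum_le_sum fun q' _ => ?_
      by_cases h : q' < dd K
      · have : AdjW False (Sum.inr q) (Sum.inr q') := by
          show q ≠ q'
          omega
        simp [hw, mkW, supψ, hqR, h, this]
      · simp [hw, mkW, supψ, hqR, h]
    have s3 : ∑ q' ∈ range N, (if q' < dd K then β else 0) = (dd K : ℝ) * β := by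
      rw [← Finset.sum_filter, Finset.sum_const, nsmul_eq_mul, hcardR]
    rw [s3] at s2
    rw [s1]; linarith

/-- constants of the subsolution -/
noncomputable def cc : ℕ → ℝ
  | 0 => -1 / 8
  | j + 1 => cc j - (1 / 4) ^ dd j / dd j + 1 / dd (j + 1) + 2 / mm (j + 1)

/-- subsolution -/
noncomputable def uu (K : ℕ) (j l : ℕ) : ℝ :=
  1 - ((j : ℝ) + l / dd j) / K + cc j - (1 / 4) ^ l / dd j

lemma cc_le (j : ℕ) : cc j ≤ -2 / dd j := by
  induction j with
  | zero => simp [cc, dd]; norm_num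
  | succ j ih =>
    have hd : (0 : ℝ) < dd j := by exact_mod_cast dd_pos j
    have hm : (4 : ℝ) * dd j ≤ mm (j + 1) := by
      rw [mm_succ]
      have h1 := mm_pos j
      have h2 : 4 ^ 1 ≤ 4 ^ dd j := Nat.pow_le_pow_right (by norm_num) (dd_pos j)
      have : 4 * dd j ≤ dd j * mm j * 4 ^ dd j := by
        calc 4 * dd j = dd j * 1 * 4 ^ 1 := by ring
          _ ≤ _ := by gcongr; exact h1
      exact_mod_cast this
    have hm2 : (2 : ℝ) / mm (j + 1) ≤ 1 / (2 * dd j) := by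
      rw [div_le_div_iff₀ (by linarith) (by positivity)]; linarith
    have h4 : 0 ≤ (1 / 4 : ℝ) ^ dd j / dd j := by positivity
    rw [cc, dd_succ]
    push_cast
    have e1 : (-2 : ℝ) / (2 * dd j) = -2 / dd j + 1 / (2 * dd j) + 1 / (2 * dd j) := by field_simp; norm_num
    rw [e1]
    linarith

lemma cc_neg (j : ℕ) : cc j ≤ 0 := by
  refine (cc_le j).trans ?_
  apply div_nonpos_of_nonpos_of_nonneg <;> [norm_num; positivity]

lemma uu_le_one (K j l : ℕ) : uu K j l ≤ 1 := by
  have h1 := cc_neg j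
  have h2 : 0 ≤ ((j : ℝ) + l / dd j) / K := by positivity
  have h3 : 0 ≤ (1 / 4 : ℝ) ^ l / dd j := by positivity
  unfold uu; linarith

lemma uu_jump (K j : ℕ) : uu K (j + 1) 0 - uu K j (dd j) = 2 / mm (j + 1) := by
  have hd : (0 : ℝ) < dd j := by exact_mod_cast dd_pos j
  unfold uu
  rw [cc, div_self hd.ne']
  push_cast
  ring

lemma sub_H (K N : ℕ) (hN : dd K ≤ N) (p : HV) (hp : p ∈ Hset K) :
    -(4 / (K : ℝ)) ≤ lapW K N True (mkW (fun j l => max (uu K j l) 0) (fun _ => 0)) (Sum.inl p) := by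
  have hp' := mem_Hset.1 hp
  have hR : 2 * dd p.1 ≤ dd K := by
    rw [← dd_succ]; exact dd_mono hp'.1
  rw [lapW_H K N (dd K) True _ _ 0 (by intro q hq; rfl) hN p hp hR]
  obtain ⟨j, l, i, s⟩ := p
  simp only [if_true] at *
  have hK : (0 : ℝ) < K := by exact_mod_cast (Nat.zero_le j).trans_lt hp'.1
  have h4K : 0 < 4 / (K : ℝ) := by positivity
  have hdpos : (0 : ℝ) < dd j := by exact_mod_cast dd_pos j
  rcases le_or_gt (uu K j l) 0 with hu | hu
  · rw [max_eq_right hu]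
    refine le_trans (neg_nonpos.2 h4K.le) ?_
    simp only [sub_zero]
    have hm : ∀ j l, 0 ≤ max (uu K j l) 0 := fun j l => le_max_right _ _
    have g1 := hm j (l + 1)
    have g2 := hm j (l - 1)
    have g3 := hm (j + 1) 0
    have g4 := hm (j - 1) (dd (j - 1))
    simp only [mul_zero, ite_self, add_zero]
    refine add_nonneg (add_nonneg ?_ ?_) (add_nonneg ?_ ?_) <;> split_ifs <;> positivity
  · rw [max_eq_left hu.le]
    have hm : ∀ j l, uu K j l ≤ max (uu K j l) 0 := fun j l => le_max_left _ _
    have hj := dd_pos j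
    have h1 := uu_le_one K j l
    have up : uu K j (l + 1) - uu K j l = -(1 / (dd j * K)) + 3 / 4 * ((1 / 4) ^ l / dd j) := by
      unfold uu; rw [pow_succ]; push_cast; field_simp; ring
    have down : 0 < l → uu K j (l - 1) - uu K j l = 1 / (dd j * K) - 3 * ((1 / 4) ^ l / dd j) := by
      intro hl
      obtain ⟨k, rfl⟩ : ∃ k, l = k + 1 := ⟨l - 1, by omega⟩
      rw [Nat.add_sub_cancel]
      unfold uu; rw [pow_succ]; push_cast; field_simp; ring
    have e4 : 4 * (dd j : ℝ) * (1 / (dd j * K)) = 4 / K := by field_simp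
    have e1 : (dd j : ℝ) * (1 / (dd j * K)) = 1 / K := by field_simp
    have e41 : 4 / (K : ℝ) = 4 * (1 / K) := by ring
    have hKi : 0 < 1 / (K : ℝ) := by positivity
    by_cases h0 : l = 0
    · have hlt : l < dd j := by omega
      rw [if_pos hlt, if_neg (show ¬ 0 < l by omega), if_neg (show ¬ (l = dd j ∧ j + 1 < K) by omega),
        if_neg (show ¬ l = dd j by omega), if_pos h0]
      have t1 : 4 * (dd j : ℝ) * (max (uu K j (l + 1)) 0 - uu K j l) ≥ -(4 / K) + 3 := by
        calc _ ≥ 4 * (dd j : ℝ) * (uu K j (l + 1) - uu K j l) := by gcongr; exact hm _ _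
          _ = _ := by rw [up, h0]; field_simp
      have t2 : (if l = 0 ∧ 0 < j then (mm j : ℝ) * (max (uu K (j - 1) (dd (j - 1))) 0 - uu K j l) else 0)
          ≥ -2 := by
        split_ifs with h
        · obtain ⟨k, rfl⟩ : ∃ k, j = k + 1 := ⟨j - 1, by omega⟩
          have hmp : (0 : ℝ) < mm (k + 1) := by exact_mod_cast mm_pos _
          have hjump := uu_jump K k
          rw [Nat.add_sub_cancel, h0]
          calc _ ≥ (mm (k + 1) : ℝ) * (uu K k (dd k) - uu K (k + 1) 0) := by gcongr; exact hm _ _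
            _ = -((mm (k + 1) : ℝ) * (uu K (k + 1) 0 - uu K k (dd k))) := by ring
            _ = -2 := by rw [hjump]; field_simp
        · norm_num
      linarith
    · have hpos : 0 < l := by omega
      by_cases hl : l = dd j
      · have hjK : j + 1 < K := by
          by_contra hc
          have : (K : ℝ) = j + 1 := by
            have : K = j + 1 := by omega
            rw [this]; push_cast; ring
          have h5 : uu K j l ≤ 0 := by
            unfold uu
            rw [hl, div_self hdpos.ne', this, div_self (by positivity)]
            have := cc_neg j
            have h3 : 0 ≤ (1 / 4 : ℝ) ^ dd j / dd j := by positivity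
            linarith
          linarith
        rw [if_neg (by omega), if_pos hpos, if_pos ⟨hl, hjK⟩, if_neg (by omega), if_pos hl, if_neg h0]
        have t1 : (dd j : ℝ) * (max (uu K j (l - 1)) 0 - uu K j l) ≥ -3 := by
          calc _ ≥ (dd j : ℝ) * (uu K j (l - 1) - uu K j l) := by gcongr; exact hm _ _
            _ = 1 / K - 3 * (1 / 4) ^ l := by rw [down hpos]; field_simp
            _ ≥ -3 := by
              have : (1 / 4 : ℝ) ^ l ≤ 1 := pow_le_one₀ (by norm_num) (by norm_num)
              linarith
        have t2 : (mm (j + 1) : ℝ) * dd (j + 1) * (max (uu K (j + 1) 0) 0 - uu K j l) ≥ 4 * dd j := by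
          have hmp : (0 : ℝ) < mm (j + 1) := by exact_mod_cast mm_pos _
          have hjump := uu_jump K j
          calc _ ≥ (mm (j + 1) : ℝ) * dd (j + 1) * (uu K (j + 1) 0 - uu K j l) := by gcongr; exact hm _ _
            _ = _ := by rw [hl, hjump, dd_succ]; push_cast; field_simp; ring
        have t3 : 2 * (dd j : ℝ) * (0 - uu K j l) ≥ -(2 * dd j) := by nlinarith
        have t4 : (2 : ℝ) ≤ dd j := by
          have : 2 ≤ dd j := by unfold dd; have := Nat.one_le_two_pow (n := j); omega
          exact_mod_cast this
        linarith
      · have hlt : l < dd j := by omega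
        rw [if_pos hlt, if_pos hpos, if_neg (by omega), if_neg (by omega), if_neg hl, if_neg h0]
        have t1 : 4 * (dd j : ℝ) * (max (uu K j (l + 1)) 0 - uu K j l) ≥
            -(4 / K) + 3 * (1 / 4) ^ l := by
          calc _ ≥ 4 * (dd j : ℝ) * (uu K j (l + 1) - uu K j l) := by gcongr; exact hm _ _
            _ = _ := by rw [up]; field_simp
        have t2 : (dd j : ℝ) * (max (uu K j (l - 1)) 0 - uu K j l) ≥ 1 / K - 3 * (1 / 4) ^ l := by
          calc _ ≥ (dd j : ℝ) * (uu K j (l - 1) - uu K j l) := by gcongr; exact hm _ _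
            _ = _ := by rw [down hpos]; field_simp
        linarith

lemma sub_hub (K N : ℕ) (q : ℕ) :
    0 ≤ lapW K N True (mkW (fun j l => max (uu K j l) 0) (fun _ => 0)) (Sum.inr q) := by
  rw [lapW]
  refine Finset.sum_nonneg fun y _ => ?_
  split_ifs
  · rcases y with p | q'
    · simp [mkW]
    · simp [mkW]
  · exact le_rfl

end solutions

set_option linter.unusedSectionVars false
set_option linter.unusedVariables false

section transport
open Equiv
open scoped Pointwise

variable {α : Type*} [Fintype α] [DecidableEq α]

/-- adjacency transported along a labelling -/
def AdjL (b : Prop) (lab : α → WV) (x y : α) : Prop := AdjW b (lab x) (lab y)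

noncomputable instance (b : Prop) (lab : α → WV) : DecidableRel (AdjL b lab) :=
  fun _ _ => Classical.propDecidable _

/-- a labelling of the vertices -/
def IsLab (K N : ℕ) (lab : α → WV) : Prop :=
  Function.Injective lab ∧ ∀ v, v ∈ VS K N ↔ ∃ x, lab x = v

lemma AdjL_symm (b : Prop) (lab : α → WV) (x y : α) (h : AdjL b lab x y) : AdjL b lab y x :=
  AdjW_symm _ _ _ h

lemma AdjL_irrefl (b : Prop) (lab : α → WV) (x : α) : ¬ AdjL b lab x x := AdjW_irrefl _ _

lemma sum_lab {K N : ℕ} {lab : α → WV} (h : IsLab K N lab) (g : WV → ℝ) :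
    ∑ x, g (lab x) = ∑ v ∈ VS K N, g v := by
  have : VS K N = univ.image lab := by
    ext v; rw [h.2]; simp
  rw [this, Finset.sum_image (fun x _ y _ hxy => h.1 hxy)]

lemma lap_lab {K N : ℕ} {lab : α → WV} (h : IsLab K N lab) (b : Prop) (w : WV → ℝ) (x : α) :
    lap (AdjL b lab) (fun y => w (lab y)) x = lapW K N b w (lab x) := by
  classical
  rw [lap, lapW, ← sum_lab h]
  refine Finset.sum_congr rfl fun y _ => ?_
  exact if_congr Iff.rfl rfl rfl

/-- hub vertices -/
def Qs (lab : α → WV) : Finset α := univ.filter (fun x => (lab x).isRight = true)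

lemma mem_Qs {lab : α → WV} {x : α} : x ∈ Qs lab ↔ ∃ q, lab x = Sum.inr q := by
  simp [Qs, Sum.isRight_iff]

lemma mem_Qs_compl {lab : α → WV} {x : α} : x ∈ (Qs lab)ᶜ ↔ ∃ p, lab x = Sum.inl p := by
  rw [Finset.mem_compl, mem_Qs]
  rcases lab x with p | q <;> simp

lemma sum_compl {K N : ℕ} {lab : α → WV} (h : IsLab K N lab) (g : WV → ℝ) :
    ∑ x ∈ (Qs lab)ᶜ, g (lab x) = ∑ p ∈ Hset K, g (Sum.inl p) := by
  have := sum_lab h (fun v => if v.isRight = true then 0 else g v)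
  rw [VS_sum] at this
  simp only [Sum.isRight_inl, Sum.isRight_inr, if_true, Finset.sum_const_zero, add_zero,
    Bool.false_eq_true, if_false] at this
  rw [← this, Qs, Finset.compl_filter, Finset.sum_filter]
  refine Finset.sum_congr rfl fun x _ => ?_
  split_ifs <;> simp_all

lemma card_compl_Qs {K N : ℕ} {lab : α → WV} (h : IsLab K N lab) :
    (Qs lab)ᶜ.card = (Hset K).card := by
  have := sum_compl h (fun _ => 1)
  simp only [Finset.sum_const, nsmul_eq_mul, mul_one] at this
  exact_mod_cast this

lemma card_lab {K N : ℕ} {lab : α → WV} (h : IsLab K N lab) :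
    Fintype.card α = (Hset K).card + N := by
  have := sum_lab h (fun _ => 1)
  rw [VS_sum] at this
  simp only [Finset.sum_const, nsmul_eq_mul, mul_one, Finset.card_univ, Finset.card_range] at this
  exact_mod_cast this

lemma card_Qs {K N : ℕ} {lab : α → WV} (h : IsLab K N lab) : (Qs lab).card = N := by
  have h1 := card_lab h
  have h2 := card_compl_Qs h
  have h3 := Finset.card_add_card_compl (Qs lab)
  omega

lemma exists_hub {K N : ℕ} {lab : α → WV} (h : IsLab K N lab) {q : ℕ} (hq : q < N) :
    ∃ x, lab x = Sum.inr q := by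
  rw [← h.2]; simp [VS, hq]

lemma exists_tree {K N : ℕ} {lab : α → WV} (h : IsLab K N lab) {p : HV} (hp : p ∈ Hset K) :
    ∃ x, lab x = Sum.inl p := by
  rw [← h.2]; simp [VS, hp]

lemma lab_inl {K N : ℕ} {lab : α → WV} (h : IsLab K N lab) {x : α} {p : HV} (hx : lab x = Sum.inl p) :
    p ∈ Hset K := by
  have := (h.2 (Sum.inl p)).2 ⟨x, hx⟩
  simpa [VS] using this

lemma lab_inr {K N : ℕ} {lab : α → WV} (h : IsLab K N lab) {x : α} {q : ℕ} (hx : lab x = Sum.inr q) :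
    q < N := by
  have := (h.2 (Sum.inr q)).2 ⟨x, hx⟩
  simpa [VS] using this

/-- the generators -/
noncomputable def SS (b : Prop) (lab : α → WV) : Finset (Perm α) := gens (AdjL b lab)

lemma SS_isSwap (b : Prop) (lab : α → WV) : ∀ s ∈ SS b lab, Perm.IsSwap s := by
  intro s hs
  obtain ⟨x, y, h, rfl⟩ := mem_gens.1 hs
  exact ⟨x, y, fun e => AdjL_irrefl b lab x (by rw [← e] at h; exact h), rfl⟩

lemma AdjW_mono {x y : WV} (h : AdjW False x y) : AdjW True x y := by
  rcases x with p | q <;> rcases y with p' | q' <;> simp only [AdjW] at * <;> tauto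

lemma SS_sub (lab : α → WV) : SS False lab ⊆ SS True lab := by
  intro s hs
  obtain ⟨x, y, h, rfl⟩ := mem_gens.1 hs
  exact mem_gens.2 ⟨x, y, AdjW_mono h, rfl⟩

lemma swap_hub {K N : ℕ} {lab : α → WV} (h : IsLab K N lab) (q0 : α) (hq0 : lab q0 = Sum.inr 0) (l : ℕ) :
    ∀ x p, lab x = Sum.inl p → p.2.1 = l → swap x q0 ∈ Subgroup.closure (SS False lab : Set (Perm α)) := by
  induction l with
  | zero =>
    intro x p hx hl
    apply Subgroup.subset_closure
    refine mem_gens.2 ⟨x, q0, ?_, rfl⟩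
    rw [AdjL, hx, hq0]
    exact Or.inr ⟨hl, rfl⟩
  | succ l ih =>
    rintro x ⟨j, l', i, s⟩ hx hl
    simp only at hl
    subst hl
    have hp := mem_Hset.1 (lab_inl h hx)
    simp only at hp
    obtain ⟨y, hy⟩ := exists_tree h (p := ⟨j, l, (i / 4, s)⟩) (by
      rw [mem_Hset]
      refine ⟨hp.1, by simp only; omega, ?_, hp.2.2.2⟩
      simp only
      rw [Nat.div_lt_iff_lt_mul (by norm_num), mul_assoc, ← pow_succ]
      exact hp.2.2.1)
    refine SubmonoidClass.swap_mem_trans _ ?_ (ih y _ hy rfl)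
    apply Subgroup.subset_closure
    refine mem_gens.2 ⟨x, y, ?_, rfl⟩
    rw [AdjL, hx, hy]
    exact Or.inl (Or.inr ⟨rfl, rfl, rfl⟩)

lemma closure_SS {K N : ℕ} {lab : α → WV} (h : IsLab K N lab) (hN : 0 < N) :
    Subgroup.closure (SS False lab : Set (Perm α)) = ⊤ := by
  obtain ⟨q0, hq0⟩ := exists_hub h hN
  have key : ∀ x, swap x q0 ∈ Subgroup.closure (SS False lab : Set (Perm α)) := by
    intro x
    rcases hx : lab x with p | q
    · exact swap_hub h q0 hq0 _ x p hx rfl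
    · by_cases h0 : x = q0
      · rw [h0, swap_self]; exact one_mem _
      · apply Subgroup.subset_closure
        refine mem_gens.2 ⟨x, q0, ?_, rfl⟩
        rw [AdjL, hx, hq0]
        intro hq
        exact h0 (h.1 (by rw [hx, hq0, hq]))
  rw [eq_top_iff, ← Perm.closure_isSwap, Subgroup.closure_le]
  rintro s ⟨x, y, -, rfl⟩
  refine SubmonoidClass.swap_mem_trans _ (key x) ?_
  rw [swap_comm]; exact key y

lemma symmGen_SS {K N : ℕ} {lab : α → WV} (h : IsLab K N lab) (hN : 0 < N) (b : Prop) (hb : b = False ∨ b = True) :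
    IsSymmGen (SS b lab) := by
  refine ⟨?_, ?_, ?_⟩
  · intro h1
    obtain ⟨x, y, hne, h2⟩ := SS_isSwap b lab _ h1
    have := congrArg (fun g : Perm α => g x) h2
    simp at this
    exact hne this
  · intro s hs
    obtain ⟨x, y, h1, rfl⟩ := mem_gens.1 hs
    rw [swap_inv]; exact hs
  · rcases hb with rfl | rfl
    · exact closure_SS h hN
    · rw [eq_top_iff, ← closure_SS h hN]
      exact Subgroup.closure_mono (by exact_mod_cast SS_sub lab)

lemma SS_ssub {K N : ℕ} {lab : α → WV} (h : IsLab K N lab) (hK : 2 ≤ K) :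
    SS False lab ⊂ SS True lab := by
  rw [Finset.ssubset_iff_of_subset (SS_sub lab)]
  obtain ⟨x, hx⟩ := exists_tree h (p := ⟨0, dd 0, (0, 0)⟩) (by
    rw [mem_Hset]; refine ⟨by simp only; omega, le_rfl, ?_, dd_pos _⟩
    have := mm_pos 0
    simp only; positivity)
  obtain ⟨y, hy⟩ := exists_tree h (p := ⟨1, 0, (0, 0)⟩) (by
    rw [mem_Hset]; refine ⟨by simp only; omega, Nat.zero_le _, ?_, dd_pos _⟩
    have := mm_pos 1
    simp only; positivity)
  have hA : AdjW True (lab x) (lab y) := by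
    rw [hx, hy]; exact Or.inr ⟨trivial, Or.inl ⟨rfl, rfl, rfl⟩⟩
  have hnA : ¬ AdjW False (lab x) (lab y) := by
    rw [hx, hy]; simp [AdjW, Tr]
  refine ⟨swap x y, mem_gens.2 ⟨x, y, hA, rfl⟩, ?_⟩
  intro hmem
  obtain ⟨a, c, hac, hs⟩ := mem_gens.1 hmem
  have hxy : x ≠ y := by rintro rfl; rw [hx] at hy; simp at hy
  have h1 : swap a c x = y := by rw [← hs]; simp
  rw [swap_apply_def] at h1
  split_ifs at h1 with h2 h3
  · subst h2; subst h1; exact hnA hac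
  · subst h3; subst h1; exact hnA (AdjW_symm _ _ _ hac)
  · exact hxy h1

lemma SS_cube {K N : ℕ} {lab : α → WV} (h : IsLab K N lab) (hN : 0 < N) :
    SS True lab ⊆ SS False lab * SS False lab * SS False lab := by
  intro s hs
  obtain ⟨q0, hq0⟩ := exists_hub h hN
  obtain ⟨x, y, hA, rfl⟩ := mem_gens.1 hs
  have hxy : x ≠ y := fun e => AdjL_irrefl True lab x (by rw [← e] at hA; exact hA)
  by_cases hF : AdjW False (lab x) (lab y)
  · have : swap x y ∈ SS False lab := mem_gens.2 ⟨x, y, hF, rfl⟩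
    have e : swap x y = swap x y * swap x y * swap x y := by simp
    rw [e]
    exact Finset.mul_mem_mul (Finset.mul_mem_mul this this) this
  · have hq : ∀ p, lab x = Sum.inl p → True := fun _ _ => trivial
    have hxA : AdjL False lab x q0 ∧ AdjL False lab q0 y ∧ x ≠ q0 ∧ y ≠ q0 := by
      unfold AdjL at hA ⊢
      rcases hx : lab x with p | q <;> rcases hy : lab y with p' | q' <;> rw [hx, hy] at hA hF
      · have hX : Xr p p' ∨ Xr p' p := by
          simp only [AdjW] at hA hF; tauto
        have g1 : Ur p 0 := by
          have := dd_pos p.1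
          rcases hX with h1 | h1
          · exact Or.inl ⟨h1.1, by omega⟩
          · exact Or.inr ⟨h1.2.2, rfl⟩
        have g2 : Ur p' 0 := by
          have := dd_pos p'.1
          rcases hX with h1 | h1
          · exact Or.inr ⟨h1.2.2, rfl⟩
          · exact Or.inl ⟨h1.1, by omega⟩
        rw [hq0]
        refine ⟨g1, g2, ?_, ?_⟩
        · rintro rfl; rw [hx] at hq0; simp at hq0
        · rintro rfl; rw [hy] at hq0; simp at hq0
      · exact absurd hA hF
      · exact absurd hA hF
      · exact absurd hA hF
    obtain ⟨h1, h2, h3, h4⟩ := hxA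
    have e : swap x y = swap x q0 * swap q0 y * swap x q0 := by
      have := swap_mul_swap_mul_swap (x := y) (y := q0) (z := x) h4 hxy.symm
      rw [swap_comm q0 x, swap_comm y q0] at this
      rw [this]
    rw [e]
    exact Finset.mul_mem_mul (Finset.mul_mem_mul (mem_gens.2 ⟨_, _, h1, rfl⟩)
      (mem_gens.2 ⟨_, _, h2, rfl⟩)) (mem_gens.2 ⟨_, _, h1, rfl⟩)

lemma SS_card {K N : ℕ} {lab : α → WV} (h : IsLab K N lab) :
    (SS True lab).card ≤ (SS False lab).card + (Hset K).card ^ 2 := by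
  have hsub : SS True lab ⊆ SS False lab ∪ ((Qs lab)ᶜ ×ˢ (Qs lab)ᶜ).image (fun p => swap p.1 p.2) := by
    intro s hs
    obtain ⟨x, y, hA, rfl⟩ := mem_gens.1 hs
    rw [Finset.mem_union]
    by_cases hF : AdjW False (lab x) (lab y)
    · exact Or.inl (mem_gens.2 ⟨x, y, hF, rfl⟩)
    · right
      rw [Finset.mem_image]
      refine ⟨(x, y), ?_, rfl⟩
      rw [Finset.mem_product, mem_Qs_compl, mem_Qs_compl]
      unfold AdjL at hA
      rcases hx : lab x with p | q <;> rcases hy : lab y with p' | q' <;> rw [hx, hy] at hA hF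
      · exact ⟨⟨p, rfl⟩, ⟨p', rfl⟩⟩
      · exact absurd hA hF
      · exact absurd hA hF
      · exact absurd hA hF
  refine (Finset.card_le_card hsub).trans ((Finset.card_union_le _ _).trans ?_)
  gcongr
  refine Finset.card_image_le.trans ?_
  rw [Finset.card_product, card_compl_Qs h, sq]

lemma SS_diff_card {K N : ℕ} {lab : α → WV} (h : IsLab K N lab) :
    (SS False lab \ swapsIn (Qs lab)).card ≤ (Hset K).card * ((Hset K).card + dd K) := by
  classical
  set R : Finset α := univ.filter (fun x => ∃ q, q < dd K ∧ lab x = Sum.inr q) with hR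
  have hRc : R.card ≤ dd K := by
    have hsub : R.image lab ⊆ (range (dd K)).image Sum.inr := by
      intro v hv
      simp only [hR, Finset.mem_image, Finset.mem_filter, Finset.mem_univ, true_and] at hv
      obtain ⟨x, ⟨q, hq, hx⟩, rfl⟩ := hv
      rw [Finset.mem_image]
      exact ⟨q, Finset.mem_range.2 hq, hx.symm⟩
    have := Finset.card_le_card hsub
    rw [Finset.card_image_of_injective _ h.1] at this
    exact this.trans (Finset.card_image_le.trans (by simp))
  have hsub : SS False lab \ swapsIn (Qs lab) ⊆
      ((Qs lab)ᶜ ×ˢ ((Qs lab)ᶜ ∪ R)).image (fun p => swap p.1 p.2) := by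
    intro s hs
    obtain ⟨hs1, hs2⟩ := Finset.mem_sdiff.1 hs
    obtain ⟨x, y, hA, rfl⟩ := mem_gens.1 hs1
    have hxy : x ≠ y := fun e => AdjL_irrefl False lab x (by rw [← e] at hA; exact hA)
    have hU : ∀ p q, p ∈ Hset K → Ur p q → q < dd K := by
      intro p q hp hU
      have hp' := mem_Hset.1 hp
      have h2 : dd (p.1 + 1) ≤ dd K := dd_mono hp'.1
      rw [dd_succ] at h2
      have := dd_pos K
      rcases hU with h' | h' <;> omega
    rw [Finset.mem_image]
    unfold AdjL at hA
    rcases hx : lab x with p | q <;> rcases hy : lab y with p' | q' <;> rw [hx, hy] at hA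
    · refine ⟨(x, y), ?_, rfl⟩
      rw [Finset.mem_product, Finset.mem_union, mem_Qs_compl, mem_Qs_compl]
      exact ⟨⟨p, hx⟩, Or.inl ⟨p', hy⟩⟩
    · refine ⟨(x, y), ?_, rfl⟩
      rw [Finset.mem_product, Finset.mem_union, mem_Qs_compl]
      refine ⟨⟨p, hx⟩, Or.inr ?_⟩
      rw [hR, Finset.mem_filter]
      exact ⟨Finset.mem_univ _, q', hU p q' (lab_inl h hx) hA, hy⟩
    · refine ⟨(y, x), ?_, swap_comm _ _⟩
      rw [Finset.mem_product, Finset.mem_union, mem_Qs_compl]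
      refine ⟨⟨p', hy⟩, Or.inr ?_⟩
      rw [hR, Finset.mem_filter]
      exact ⟨Finset.mem_univ _, q, hU p' q (lab_inl h hy) hA, hx⟩
    · exact absurd (mem_swapsIn.2 ⟨x, y, mem_Qs.2 ⟨q, hx⟩, mem_Qs.2 ⟨q', hy⟩, hxy, rfl⟩) hs2
  refine (Finset.card_le_card hsub).trans (Finset.card_image_le.trans ?_)
  rw [Finset.card_product, card_compl_Qs h]
  gcongr
  refine (Finset.card_union_le _ _).trans ?_
  rw [card_compl_Qs h]; gcongr

lemma Qs_clique {K N : ℕ} {lab : α → WV} (h : IsLab K N lab) (b : Prop) :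
    ∀ x ∈ Qs lab, ∀ y ∈ Qs lab, x ≠ y → AdjL b lab x y := by
  intro x hx y hy hxy
  obtain ⟨q, hq⟩ := mem_Qs.1 hx
  obtain ⟨q', hq'⟩ := mem_Qs.1 hy
  rw [AdjL, hq, hq']
  intro e
  exact hxy (h.1 (by rw [hq, hq', e]))

lemma SS_card_ge {K N : ℕ} {lab : α → WV} (h : IsLab K N lab) (b : Prop) (k : ℕ) (hk : k ≤ N) :
    k * (N - k) ≤ (SS b lab).card := by
  have h1 := swapsIn_card_ge (Qs lab) k (by rw [card_Qs h]; exact hk)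
  rw [card_Qs h] at h1
  refine h1.trans (Finset.card_le_card ?_)
  intro s hs
  obtain ⟨a, c, ha, hb, hab, rfl⟩ := mem_swapsIn.1 hs
  exact mem_gens.2 ⟨a, c, Qs_clique h b a ha c hb hab, rfl⟩

/-- lower bound on the mixing time of the big generating set -/
lemma lower_SS [Nonempty α] {K N : ℕ} {lab : α → WV} (h : IsLab K N lab) (hK : 1 ≤ K) (hN : dd K ≤ N)
    (hN2 : 2 ≤ N) (hM : 16 * (Hset K).card < Fintype.card α * 3) (T : ℕ)
    (hT : (T : ℝ) ≤ (SS True lab).card * K / 16 + 1) :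
    T ≤ tvMixUnif (lazyCayleyP (SS True lab)) := by
  obtain ⟨x0, hx0⟩ := exists_tree h (p := ⟨0, 0, (0, 0)⟩) (by
    rw [mem_Hset]; refine ⟨by simp only; omega, Nat.zero_le _, ?_, dd_pos _⟩
    have := mm_pos 0
    simp only; positivity)
  have hcard : 0 < (SS True lab).card := by
    have := SS_card_ge h True 1 (by omega)
    omega
  have hne : (SS True lab).Nonempty := Finset.card_pos.1 hcard
  refine lower_mix _ hne (symmGen_SS h (by omega) True (Or.inr rfl)) (Qs lab)ᶜ x0 T ?_
  intro t ht
  have hKr : (0 : ℝ) < K := by exact_mod_cast hK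
  have he : (0 : ℝ) < (SS True lab).card := by exact_mod_cast hcard
  have key := Fpart_ge (AdjL True lab) (AdjL_symm True lab) (AdjL_irrefl True lab) hne (indF (Qs lab)ᶜ)
    (fun x => mkW (fun j l => max (uu K j l) 0) (fun _ => 0) (lab x)) (4 / K) (by
      intro x
      rcases hx : lab x with p | q
      · rw [indF, if_pos (mem_Qs_compl.2 ⟨p, hx⟩)]
        exact max_le (uu_le_one _ _ _) zero_le_one
      · simp only [mkW, indF]; split_ifs <;> norm_num) (by
      intro x
      rw [lap_lab h]
      rcases hx : lab x with p | q
      · exact sub_H K N hN p (lab_inl h hx)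
      · refine le_trans ?_ (sub_hub K N q)
        rw [neg_nonpos]; positivity) t x0
  refine lt_of_lt_of_le ?_ key
  have hu : mkW (fun j l => max (uu K j l) 0) (fun _ => 0) (lab x0) ≥ 13 / 16 := by
    rw [hx0]
    refine le_trans ?_ (le_max_left _ _)
    simp [uu, cc, dd]; norm_num
  have ht' : (t : ℝ) ≤ (SS True lab).card * K / 16 := by
    have : (t : ℝ) + 1 ≤ T := by exact_mod_cast ht
    linarith
  have h1 : 4 / (K : ℝ) * t / (2 * (SS True lab).card) ≤ 1 / 8 := by
    rw [div_le_iff₀ (by positivity), div_mul_eq_mul_div, div_le_iff₀ hKr]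
    nlinarith
  have h2 : ((Qs lab)ᶜ.card : ℝ) / Fintype.card α < 3 / 16 := by
    rw [card_compl_Qs h, div_lt_iff₀ (by exact_mod_cast Fintype.card_pos)]
    have : (16 : ℝ) * (Hset K).card < Fintype.card α * 3 := by exact_mod_cast hM
    linarith
  have h1' : 4 / (K : ℝ) * t / (2 * (gens (AdjL True lab)).card) ≤ 1 / 8 := h1
  linarith

end transport

set_option linter.unusedSectionVars false
set_option linter.unusedVariables false

section upperPart
open Equiv

lemma sixteen_le_dd (j : ℕ) : 16 ≤ dd j := by
  unfold dd; have := Nat.one_le_two_pow (n := j); omega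

lemma mm_succ_le (j : ℕ) : mm j ≤ 2 ^ (4 * dd j) ∧ mm (j + 1) ≤ 2 ^ (7 * dd j) := by
  have step : ∀ j, mm j ≤ 2 ^ (4 * dd j) → mm (j + 1) ≤ 2 ^ (7 * dd j) := by
    intro j h
    rw [mm_succ]
    have h1 : dd j ≤ 2 ^ dd j := Nat.lt_two_pow_self.le
    calc dd j * mm j * 4 ^ dd j ≤ 2 ^ dd j * 2 ^ (4 * dd j) * 4 ^ dd j := by gcongr
      _ = 2 ^ (7 * dd j) := by
        rw [show (4 : ℕ) = 2 ^ 2 by norm_num, ← pow_mul, ← pow_add, ← pow_add]; congr 1; ring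
  have h0 : mm j ≤ 2 ^ (4 * dd j) := by
    induction j with
    | zero => simp [mm]; exact Nat.one_le_two_pow
    | succ j ih =>
      refine (step j ih).trans ?_
      rw [dd_succ]
      exact Nat.pow_le_pow_right (by norm_num) (by omega)
  exact ⟨h0, step j h0⟩

lemma sum_pow4_le (d : ℕ) : ∑ l ∈ range (d + 1), (4 : ℝ) ^ l * 2 ^ (d - l) ≤ 2 * 4 ^ d := by
  have h : ∀ l ∈ range (d + 1), (4 : ℝ) ^ l * 2 ^ (d - l) = 2 ^ d * 2 ^ l := by
    intro l hl
    rw [Finset.mem_range] at hl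
    rw [show (4 : ℝ) = 2 * 2 by norm_num, mul_pow, mul_assoc, ← pow_add, Nat.add_sub_cancel' (by omega)]
    ring
  rw [Finset.sum_congr rfl h, ← Finset.mul_sum]
  have g : ∑ l ∈ range (d + 1), (2 : ℝ) ^ l ≤ 2 ^ (d + 1) := by
    rw [geom_sum_eq (by norm_num)]; norm_num
  calc (2 : ℝ) ^ d * ∑ l ∈ range (d + 1), (2 : ℝ) ^ l ≤ 2 ^ d * 2 ^ (d + 1) := by gcongr
    _ = 2 * 4 ^ d := by
      rw [show (4 : ℝ) = 2 * 2 by norm_num, mul_pow, pow_succ]; ring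

lemma sum_class_le (K : ℕ) (ρ : ℕ → ℝ) (hρ : ∀ j < K, 0 ≤ ρ j) :
    ∑ p ∈ Hset K, 2 ^ (dd p.1 - p.2.1) * ρ p.1 ≤ ∑ j ∈ range K, 2 * mm (j + 1) * ρ j := by
  rw [sum_H_class K (fun j l => 2 ^ (dd j - l) * ρ j)]
  refine Finset.sum_le_sum fun j hj => ?_
  have h1 : ∑ l ∈ range (dd j + 1), (mm j : ℝ) * 4 ^ l * dd j * (2 ^ (dd j - l) * ρ j) =
      mm j * dd j * ρ j * ∑ l ∈ range (dd j + 1), (4 : ℝ) ^ l * 2 ^ (dd j - l) := by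
    rw [Finset.mul_sum]
    refine Finset.sum_congr rfl fun l _ => ?_
    ring
  rw [h1, mm_succ]
  have h2 := hρ j (Finset.mem_range.1 hj)
  calc (mm j : ℝ) * dd j * ρ j * ∑ l ∈ range (dd j + 1), (4 : ℝ) ^ l * 2 ^ (dd j - l)
      ≤ mm j * dd j * ρ j * (2 * 4 ^ dd j) := by
        gcongr; exact sum_pow4_le _
    _ = _ := by push_cast; ring

lemma Hset_card_le (K : ℕ) : (Hset K).card ≤ (2 ^ dd K) ^ 5 := by
  have h1 := sum_class_le K (fun _ => 1) (fun _ _ => zero_le_one)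
  have h2 : ((Hset K).card : ℝ) ≤ ∑ p ∈ Hset K, 2 ^ (dd p.1 - p.2.1) * (1 : ℝ) := by
    rw [Finset.card_eq_sum_ones]
    push_cast
    refine Finset.sum_le_sum fun p _ => ?_
    rw [mul_one]
    exact one_le_pow₀ (by norm_num)
  have h3 : ∑ j ∈ range K, 2 * (mm (j + 1) : ℝ) * 1 ≤ ∑ j ∈ range K, 2 * (2 ^ dd K) ^ 4 := by
    refine Finset.sum_le_sum fun j hj => ?_
    rw [mul_one]
    gcongr
    have h4 := (mm_succ_le (j + 1)).1
    have h5 : mm (j + 1) ≤ (2 ^ dd K) ^ 4 := by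
      refine h4.trans ?_
      rw [← pow_mul, mul_comm (dd K)]
      have : dd (j + 1) ≤ dd K := dd_mono (Finset.mem_range.1 hj)
      exact Nat.pow_le_pow_right (by norm_num) (by omega)
    exact_mod_cast h5
  rw [Finset.sum_const, Finset.card_range, nsmul_eq_mul] at h3
  have h6 : 2 * K ≤ 2 ^ dd K := by
    have a1 : dd K ≤ 2 ^ dd K := Nat.lt_two_pow_self.le
    have a2 : K ≤ 2 ^ K := Nat.lt_two_pow_self.le
    have : dd K = 16 * 2 ^ K := rfl
    omega
  have h7 : (2 * K : ℝ) ≤ 2 ^ dd K := by exact_mod_cast h6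
  have h8 : ((Hset K).card : ℝ) ≤ (2 ^ dd K) ^ 5 := by
    calc ((Hset K).card : ℝ) ≤ K * (2 * (2 ^ dd K) ^ 4) := h2.trans (h1.trans h3)
      _ = (2 * K) * (2 ^ dd K) ^ 4 := by ring
      _ ≤ 2 ^ dd K * (2 ^ dd K) ^ 4 := by gcongr
      _ = _ := by ring
  exact_mod_cast h8

lemma exp_seven (d : ℕ) : Real.exp (-(7 * d)) ≤ (1 / 2) ^ (10 * d) := by
  have h1 : (1024 : ℝ) ≤ Real.exp 7 := by
    have : Real.exp 7 = Real.exp 1 ^ 7 := by rw [← Real.exp_nat_mul]; norm_num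
    rw [this]
    calc (1024 : ℝ) ≤ 2.7 ^ 7 := by norm_num
      _ ≤ _ := by
        have := Real.exp_one_gt_d9
        gcongr; linarith
  have h2 : Real.exp (-(7 * d)) = (Real.exp 7)⁻¹ ^ d := by
    rw [← Real.exp_neg, ← Real.exp_nat_mul]; congr 1; ring
  rw [h2, pow_mul]
  gcongr
  rw [inv_le_comm₀ (Real.exp_pos _) (by norm_num)]
  norm_num; exact h1

lemma rho_pow_le (d : ℕ) (e : ℕ) (he : 0 < e) (hde : (d : ℝ) ≤ 2 * e) :
    (1 - (d : ℝ) / (2 * e)) ^ (14 * e) ≤ (1 / 2) ^ (10 * d) := by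
  refine le_trans ?_ (exp_seven d)
  have he' : (0 : ℝ) < e := by exact_mod_cast he
  have h0 : 0 ≤ 1 - (d : ℝ) / (2 * e) := by
    rw [sub_nonneg, div_le_one (by positivity)]; exact hde
  have h1 : 1 - (d : ℝ) / (2 * e) ≤ Real.exp (-((d : ℝ) / (2 * e))) := by
    have := Real.add_one_le_exp (-((d : ℝ) / (2 * e)))
    linarith
  calc (1 - (d : ℝ) / (2 * e)) ^ (14 * e) ≤ Real.exp (-((d : ℝ) / (2 * e))) ^ (14 * e) := by gcongr
    _ = Real.exp (-(7 * d)) := by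
      rw [← Real.exp_nat_mul]; congr 1; push_cast; field_simp; ring

lemma exp_small (s : ℝ) (hs : 100000 ≤ s) (N : ℝ) (hN : N ≤ (s + 1) ^ 2) (hN0 : 0 ≤ N) :
    2 * N * N * Real.exp (-(s / 4)) ≤ 1 / 16 := by
  have h1 : (s / 4) ^ 6 / 720 ≤ Real.exp (s / 4) := by
    have := Real.pow_div_factorial_le_exp (s / 4) (by positivity) 6
    simpa [Nat.factorial] using this
  have h2 : N ≤ 2 * s ^ 2 := by nlinarith
  have h3 : N * N ≤ 4 * s ^ 4 := by nlinarith [mul_le_mul h2 h2 hN0 (by positivity)]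
  rw [Real.exp_neg, ← div_eq_mul_inv, div_le_iff₀ (Real.exp_pos _)]
  have h4 : (100000 : ℝ) ^ 2 ≤ s ^ 2 := by gcongr
  have h5 : (100000 : ℝ) ^ 2 * s ^ 4 ≤ s ^ 2 * s ^ 4 := by gcongr
  have h6 : s ^ 2 * s ^ 4 = s ^ 6 := by ring
  have h7 : (s / 4) ^ 6 = s ^ 6 / 4096 := by ring
  rw [h7] at h1
  nlinarith [h1, h3, h5, h6]

variable {α : Type*} [Fintype α] [DecidableEq α]

/-- bound on the tree part -/
lemma tree_sum {K N : ℕ} {lab : α → WV} (h : IsLab K N lab) (hN : (2 ^ dd K) ^ 90 ≤ N) :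
    ∑ x ∈ (Qs lab)ᶜ, Fpart (SS False lab) (indF (Qs lab)ᶜ) (14 * (SS False lab).card) x ≤ 1 / 16 := by
  set A : ℕ := 2 ^ dd K with hA
  have hdA : dd K ≤ A := Nat.lt_two_pow_self.le
  have hA16 : 2 ^ 16 ≤ A := Nat.pow_le_pow_right (by norm_num) (sixteen_le_dd K)
  have hAN : A ^ 2 ≤ N := le_trans (Nat.pow_le_pow_right (by omega) (by norm_num)) hN
  have hA2 : 2 * A ≤ N := by nlinarith
  set e := (SS False lab).card with he
  have hcard : N - 1 ≤ e := by
    have := SS_card_ge h False 1 (by omega)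
    omega
  have he0 : 0 < e := by omega
  have heR : (0 : ℝ) < e := by exact_mod_cast he0
  have hne : (SS False lab).Nonempty := Finset.card_pos.1 he0
  have hde : (dd K : ℝ) ≤ 2 * e := by
    have : dd K ≤ 2 * e := by omega
    exact_mod_cast this
  set β : ℝ := (Hset K).card * 2 ^ dd K / ((N : ℝ) - dd K) with hβ
  set η : ℝ := dd K * β with hη
  have hNR : (N : ℝ) / 2 ≤ (N : ℝ) - dd K := by
    have : (2 : ℝ) * A ≤ N := by exact_mod_cast hA2
    have h2 : (dd K : ℝ) ≤ A := by exact_mod_cast hdA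
    linarith
  have hN0 : (0 : ℝ) < N := by
    have : 0 < N := by omega
    exact_mod_cast this
  have hNR0 : (0 : ℝ) < (N : ℝ) - dd K := by linarith
  have hβ0 : 0 ≤ β := by positivity
  have hη0 : 0 ≤ η := by positivity
  have key := Fpart_le (AdjL False lab) (AdjL_symm False lab) (AdjL_irrefl False lab) hne (indF (Qs lab)ᶜ)
    (fun t x => mkW (supφ e β η t) (supψ (dd K) e β η t) (lab x)) (by
      intro x
      rcases hx : lab x with p | q
      · rw [indF, if_pos (mem_Qs_compl.2 ⟨p, hx⟩)]
        simp only [mkW, supφ, pow_zero, mul_one]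
        have : (1 : ℝ) ≤ 2 ^ (dd p.1 - p.2.1) := one_le_pow₀ (by norm_num)
        have h2 : 0 ≤ η * ((0 : ℕ) : ℝ) / (2 * e) := by positivity
        linarith
      · have hx' : x ∉ (Qs lab)ᶜ := by
          rw [Finset.mem_compl, not_not]; exact mem_Qs.2 ⟨q, hx⟩
        rw [indF, if_neg hx']
        simp only [mkW, supψ]
        split_ifs <;> positivity) (by
      intro t x
      rw [lap_lab h False (mkW (supφ e β η t) (supψ (dd K) e β η t))]
      rcases hx : lab x with p | q
      · exact super_H K N e β η heR hη0 (by omega) hde t p (lab_inl h hx)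
      · exact super_hub K N e β η heR (by omega) hde rfl rfl t q (lab_inr h hx)) (14 * e)
  refine (Finset.sum_le_sum fun x _ => key x).trans ?_
  rw [sum_compl h (fun v => mkW (supφ e β η (14 * e)) (supψ (dd K) e β η (14 * e)) v)]
  simp only [mkW, supφ]
  rw [Finset.sum_add_distrib, Finset.sum_const, nsmul_eq_mul]
  have b1 : ∑ p ∈ Hset K, (2 : ℝ) ^ (dd p.1 - p.2.1) * (1 - dd p.1 / (2 * e)) ^ (14 * e) ≤ 1 / 32 := by
    have hdj : ∀ j < K, (dd j : ℝ) ≤ 2 * e := fun j hj => le_trans (by exact_mod_cast dd_mono hj.le) hde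
    refine (sum_class_le K (fun j => (1 - dd j / (2 * e)) ^ (14 * e)) ?_).trans ?_
    · intro j hj
      apply pow_nonneg
      rw [sub_nonneg, div_le_one (by positivity)]
      exact hdj j hj
    · calc ∑ j ∈ range K, 2 * (mm (j + 1) : ℝ) * (1 - dd j / (2 * e)) ^ (14 * e)
          ≤ ∑ j ∈ range K, 1 / 64 * (1 / 2 : ℝ) ^ j := by
            refine Finset.sum_le_sum fun j hj => ?_
            have c1 := rho_pow_le (dd j) e he0 (hdj j (Finset.mem_range.1 hj))
            have c2 : (mm (j + 1) : ℝ) ≤ 2 ^ (7 * dd j) := by exact_mod_cast (mm_succ_le j).2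
            calc 2 * (mm (j + 1) : ℝ) * (1 - dd j / (2 * e)) ^ (14 * e)
                ≤ 2 * 2 ^ (7 * dd j) * (1 / 2) ^ (10 * dd j) := by
                  gcongr
                  apply pow_nonneg
                  rw [sub_nonneg, div_le_one (by positivity)]
                  exact hdj j (Finset.mem_range.1 hj)
              _ = 2 * (1 / 2) ^ (3 * dd j) := by
                rw [show 10 * dd j = 7 * dd j + 3 * dd j by ring, pow_add, ← mul_assoc,
                  mul_assoc 2 ((2 : ℝ) ^ (7 * dd j)), ← mul_pow]
                norm_num
              _ ≤ 2 * (1 / 2) ^ (7 + j) := by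
                have : 7 + j ≤ 3 * dd j := by
                  have a2 : j ≤ 2 ^ j := Nat.lt_two_pow_self.le
                  have := sixteen_le_dd j
                  have : dd j = 16 * 2 ^ j := rfl
                  omega
                have := pow_le_pow_of_le_one (by norm_num : (0 : ℝ) ≤ 1 / 2) (by norm_num) this
                linarith
              _ = _ := by rw [pow_add]; ring
        _ ≤ 1 / 32 := by
          rw [← Finset.mul_sum]
          have := sum_geometric_two_le K
          linarith
  have b2 : ((Hset K).card : ℝ) * (β + η * ((14 * e : ℕ) : ℝ) / (2 * e)) ≤ 1 / 32 := by
    have hM : ((Hset K).card : ℝ) ≤ (A : ℝ) ^ 5 := by exact_mod_cast Hset_card_le K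
    have c1 : β + η * ((14 * e : ℕ) : ℝ) / (2 * e) = β * (1 + 7 * dd K) := by
      rw [hη]; push_cast; field_simp; ring
    have hdA' : (dd K : ℝ) ≤ A := by exact_mod_cast hdA
    have hA' : (2 : ℝ) ^ 16 ≤ A := by exact_mod_cast hA16
    have hA1 : (1 : ℝ) ≤ A := by linarith [show (1 : ℝ) ≤ 2 ^ 16 by norm_num]
    have hA0 : (0 : ℝ) < A := by linarith
    have c2 : 1 + 7 * (dd K : ℝ) ≤ (A : ℝ) ^ 2 := by
      nlinarith [show (65536 : ℝ) ≤ A by linarith [show (2 : ℝ) ^ 16 = 65536 by norm_num]]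
    have c4 : β ≤ (A : ℝ) ^ 6 / (N / 2) := by
      rw [hβ]
      have : (2 : ℝ) ^ dd K = A := by rw [hA]; push_cast; rfl
      rw [this]
      calc ((Hset K).card : ℝ) * A / ((N : ℝ) - dd K) ≤ (A : ℝ) ^ 5 * A / (N / 2) := by gcongr
        _ = _ := by ring
    have c5 : (A : ℝ) ^ 14 ≤ N := by
      have : A ^ 14 ≤ N := le_trans (Nat.pow_le_pow_right (by omega) (by norm_num)) hN
      exact_mod_cast this
    rw [c1]
    calc ((Hset K).card : ℝ) * (β * (1 + 7 * dd K)) ≤ (A : ℝ) ^ 5 * ((A : ℝ) ^ 6 / (N / 2) * (A : ℝ) ^ 2) := by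
          gcongr
      _ = 2 * (A : ℝ) ^ 13 / N := by field_simp
      _ ≤ 2 * (A : ℝ) ^ 13 / A ^ 14 := by gcongr
      _ = 2 / A := by field_simp
      _ ≤ 1 / 32 := by
        rw [div_le_div_iff₀ hA0 (by norm_num)]
        linarith [show (2 : ℝ) ^ 16 = 65536 by norm_num]
  linarith

lemma upper_SS [Nonempty α] {K N : ℕ} {lab : α → WV} (h : IsLab K N lab) (hN : (2 ^ dd K) ^ 90 ≤ N) :
    tvMixUnif (lazyCayleyP (SS False lab)) ≤ 16 * (SS False lab).card := by
  have htree := tree_sum h hN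
  set A : ℕ := 2 ^ dd K with hA
  have hdA : dd K ≤ A := Nat.lt_two_pow_self.le
  have hA16 : 2 ^ 16 ≤ A := Nat.pow_le_pow_right (by norm_num) (sixteen_le_dd K)
  have hAN : A ^ 2 ≤ N := le_trans (Nat.pow_le_pow_right (by omega) (by norm_num)) hN
  have hA2 : 2 * A ≤ N := by nlinarith
  have hM : (Hset K).card ≤ A ^ 5 := Hset_card_le K
  set e := (SS False lab).card with he
  have he5 : N * N ≤ 5 * e := by
    have h1 := SS_card_ge h False (N / 2) (by omega)
    rw [← he] at h1
    obtain ⟨k, hk⟩ : ∃ k, k = N / 2 := ⟨_, rfl⟩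
    rw [← hk] at h1
    rcases Nat.even_or_odd' N with ⟨r, hr | hr⟩
    · have : k = r := by omega
      subst this
      have h2 : N - k = k := by omega
      rw [h2] at h1; rw [hr]; nlinarith
    · have : k = r := by omega
      subst this
      have h2 : N - k = k + 1 := by omega
      rw [h2] at h1; rw [hr]
      have : 1 ≤ k := by omega
      nlinarith
  set s := Nat.sqrt N with hs
  have hs1 : s * s ≤ N := Nat.sqrt_le N
  have hs2 : N < (s + 1) * (s + 1) := Nat.sqrt_lt.1 (Nat.lt_succ_self _)
  have hs3 : A ^ 45 ≤ s := by
    rw [hs, Nat.le_sqrt, ← pow_add]; exact hN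
  have hs4 : A ^ 13 ≤ s := le_trans (Nat.pow_le_pow_right (by omega) (by norm_num)) hs3
  have hs5 : A ^ 2 ≤ s := le_trans (Nat.pow_le_pow_right (by omega) (by norm_num)) hs3
  have hs6 : 100000 ≤ s := by nlinarith
  have ht1 : N * s ≤ e := by nlinarith
  have he0 : 0 < e := by nlinarith
  have hmain : tvMixUnif (lazyCayleyP (SS False lab)) ≤ 2 * (N * s) + 14 * e := by
    refine upper_mix (AdjL False lab) (AdjL_symm False lab) (AdjL_irrefl False lab) (Qs lab)
      (Qs_clique h False) (by rw [card_Qs h]; omega) (N * s) (14 * e) ?_ ?_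
    · rw [card_Qs h]
      have hN0 : (0 : ℝ) < N := by
        have : 0 < N := by omega
        exact_mod_cast this
      have p1 : 2 * (N : ℝ) * N * (1 - 1 / (4 * (N : ℝ))) ^ (N * s) ≤ 1 / 16 := by
        refine le_trans ?_ (exp_small s (by exact_mod_cast hs6) N ?_ hN0.le)
        · have h0 : 0 ≤ 1 - 1 / (4 * (N : ℝ)) := by
            rw [sub_nonneg, div_le_one (by positivity)]
            have : 1 ≤ N := by omega
            have : (1 : ℝ) ≤ N := by exact_mod_cast this
            linarith
          have h1 : 1 - 1 / (4 * (N : ℝ)) ≤ Real.exp (-(1 / (4 * (N : ℝ)))) := by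
            have := Real.add_one_le_exp (-(1 / (4 * (N : ℝ))))
            linarith
          have h2 : (1 - 1 / (4 * (N : ℝ))) ^ (N * s) ≤ Real.exp (-((s : ℝ) / 4)) := by
            calc (1 - 1 / (4 * (N : ℝ))) ^ (N * s) ≤ Real.exp (-(1 / (4 * (N : ℝ)))) ^ (N * s) := by gcongr
              _ = _ := by
                rw [← Real.exp_nat_mul]; congr 1; push_cast; field_simp
          gcongr
        · have : N ≤ (s + 1) ^ 2 := by rw [sq]; exact hs2.le
          exact_mod_cast this
      have p2 : ((N * s : ℕ) : ℝ) * (((gens (AdjL False lab) \ swapsIn (Qs lab)).card : ℝ) /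
          (gens (AdjL False lab)).card) ≤ 1 / 16 := by
        have hD : (SS False lab \ swapsIn (Qs lab)).card ≤ A ^ 12 := by
          refine (SS_diff_card h).trans ?_
          have q1 : (Hset K).card + dd K ≤ A ^ 7 := by
            have q2 : A ^ 5 * 2 ≤ A ^ 7 := by
              rw [show A ^ 7 = A ^ 5 * A ^ 2 by ring]
              apply Nat.mul_le_mul_left; nlinarith
            have q3 : A ≤ A ^ 5 := Nat.le_self_pow (by norm_num) A
            omega
          calc (Hset K).card * ((Hset K).card + dd K) ≤ A ^ 5 * A ^ 7 := Nat.mul_le_mul hM q1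
            _ = A ^ 12 := by ring
        have hD2 : 80 * A ^ 12 ≤ s := by
          refine le_trans ?_ hs4
          rw [pow_succ A 12, mul_comm 80]
          apply Nat.mul_le_mul_left; omega
        have hD3 : 16 * (N * s * (SS False lab \ swapsIn (Qs lab)).card) ≤ e := by
          have z1 : 16 * (N * s * (SS False lab \ swapsIn (Qs lab)).card) ≤ 16 * (N * s * A ^ 12) := by gcongr
          have z2 : N * s * (80 * A ^ 12) ≤ N * s * s := by gcongr
          have z3 : N * s * s ≤ N * N := by rw [mul_assoc]; gcongr
          nlinarith
        have heR : (0 : ℝ) < e := by exact_mod_cast he0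
        change ((N * s : ℕ) : ℝ) * (((SS False lab \ swapsIn (Qs lab)).card : ℝ) / e) ≤ 1 / 16
        rw [← mul_div_assoc, div_le_div_iff₀ heR (by norm_num)]
        have : (16 : ℝ) * (((N * s : ℕ) : ℝ) * (SS False lab \ swapsIn (Qs lab)).card) ≤ e := by
          exact_mod_cast hD3
        linarith
      linarith
    · have p3 : ((Qs lab)ᶜ.card : ℝ) ^ 2 / Fintype.card α ≤ 1 / 16 := by
        rw [card_compl_Qs h, card_lab h, div_le_div_iff₀ (by
          have : 0 < (Hset K).card + N := by omega
          exact_mod_cast this) (by norm_num)]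
        have q1 : (Hset K).card ^ 2 * 16 ≤ 1 * ((Hset K).card + N) := by
          have q2 : (Hset K).card ^ 2 ≤ (A ^ 5) ^ 2 := by gcongr
          have q3 : (A ^ 5) ^ 2 * 16 ≤ A ^ 11 := by
            rw [← pow_mul, pow_succ A 10]
            apply Nat.mul_le_mul_left; omega
          have q4 : A ^ 11 ≤ N := le_trans (Nat.pow_le_pow_right (by omega) (by norm_num)) hN
          omega
        exact_mod_cast q1
      have htree' : ∑ x ∈ (Qs lab)ᶜ, Fpart (gens (AdjL False lab)) (indF (Qs lab)ᶜ) (14 * e) x ≤ 1 / 16 := htree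
      linarith
  omega

end upperPart

set_option linter.unusedSectionVars false
set_option linter.unusedVariables false

section finalPart

lemma exists_lab (K N n : ℕ) (hn : (Hset K).card + N = n) : ∃ lab : Fin n → WV, IsLab K N lab := by
  have hc : (VS K N).card = n := by
    rw [VS, Finset.card_disjSum, Finset.card_range, hn]
  let f : {v // v ∈ VS K N} ≃ Fin n := (VS K N).equivFin.trans (finCongr hc)
  refine ⟨fun x => (f.symm x).1, ?_, ?_⟩
  · intro x y hxy
    exact f.symm.injective (Subtype.ext hxy)
  · intro v
    constructor
    · intro hv
      exact ⟨f ⟨v, hv⟩, by simp⟩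
    · rintro ⟨x, rfl⟩
      exact (f.symm x).2

lemma logloglog_le (n q : ℕ) (hn : 3 ≤ n) (hq : q = Nat.log 2 (Nat.log 2 n)) :
    Real.log (Real.log (Real.log (n.factorial : ℝ))) ≤ q + 2 := by
  have hn0 : (0 : ℝ) < n := by
    have : 0 < n := by omega
    exact_mod_cast this
  have hl2 : Real.log 2 ≤ 1 := by linarith [Real.log_two_lt_d9]
  have hl2' : 0 ≤ Real.log 2 := Real.log_nonneg (by norm_num)
  set p := Nat.log 2 n with hp
  have a1 : n < 2 ^ (p + 1) := Nat.lt_pow_succ_log_self (by norm_num) n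
  have a2 : p < 2 ^ (q + 1) := by rw [hq]; exact Nat.lt_pow_succ_log_self (by norm_num) p
  have b0 : (6 : ℝ) ≤ n.factorial := by
    have : (3 : ℕ).factorial ≤ n.factorial := Nat.factorial_le hn
    have h6 : (3 : ℕ).factorial = 6 := rfl
    rw [h6] at this
    exact_mod_cast this
  have b1 : 1 < Real.log (n.factorial : ℝ) := by
    rw [Real.lt_log_iff_exp_lt (by linarith)]
    linarith [Real.exp_one_lt_d9]
  have b2 : Real.log (n.factorial : ℝ) ≤ (n : ℝ) ^ 2 := by
    have h1 : (n.factorial : ℝ) ≤ (n : ℝ) ^ n := by exact_mod_cast Nat.factorial_le_pow n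
    have h2 := Real.log_le_log (by linarith) h1
    rw [Real.log_pow] at h2
    have h3 := Real.log_le_self hn0.le
    nlinarith
  have b3 : Real.log (Real.log (n.factorial : ℝ)) ≤ 2 * Real.log n := by
    have := Real.log_le_log (by linarith) b2
    rw [Real.log_pow] at this
    exact_mod_cast this
  have b4 : Real.log n ≤ (2 : ℝ) ^ (q + 1) := by
    have h1 : (n : ℝ) ≤ 2 ^ (p + 1) := by exact_mod_cast a1.le
    have h2 := Real.log_le_log hn0 h1
    rw [Real.log_pow] at h2
    have h3 : ((p + 1 : ℕ) : ℝ) ≤ 2 ^ (q + 1) := by exact_mod_cast a2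
    have h4 : (0 : ℝ) ≤ ((p + 1 : ℕ) : ℝ) := by positivity
    nlinarith
  have b5 : Real.log (Real.log (n.factorial : ℝ)) ≤ (2 : ℝ) ^ (q + 2) := by
    have : (2 : ℝ) ^ (q + 2) = 2 * 2 ^ (q + 1) := by ring
    rw [this]; linarith
  have b6 : 0 < Real.log (Real.log (n.factorial : ℝ)) := Real.log_pos b1
  have b7 := Real.log_le_log b6 b5
  rw [Real.log_pow] at b7
  have h4 : (0 : ℝ) ≤ ((q + 2 : ℕ) : ℝ) := by positivity
  have h5 : ((q + 2 : ℕ) : ℝ) * Real.log 2 ≤ ((q + 2 : ℕ) : ℝ) := by nlinarith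
  push_cast at *
  linarith

end finalPart

/-- Adding at most `√|S|` extra generators, each a product of three generators of `S`, can
increase the mixing time of the Cayley graph of the symmetric group by a factor of order
`log log log (n!)`. -/
theorem mixing_sensitive_under_adding_few_generators :
    ∃ c > (0 : ℝ), ∃ N : ℕ, ∀ n : ℕ, N ≤ n →
      ∃ S S' : Finset (Equiv.Perm (Fin n)),
        (∀ s ∈ S, Equiv.Perm.IsSwap s) ∧ (∀ s ∈ S', Equiv.Perm.IsSwap s) ∧
        IsSymmGen S ∧ IsSymmGen S' ∧
        S ⊂ S' ∧ S' ⊆ S * S * S ∧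
        ((S'.card : ℝ) - (S.card : ℝ) ≤ Real.sqrt (S.card : ℝ)) ∧
        (tvMixUnif (lazyCayleyP S') : ℝ) ≥
          c * (tvMixUnif (lazyCayleyP S) : ℝ) *
            Real.log (Real.log (Real.log (n.factorial : ℝ))) := by
  refine ⟨1 / 1024, by norm_num, 2 ^ (2 ^ 16), fun n hn => ?_⟩
  obtain ⟨q, hq⟩ : ∃ q, q = Nat.log 2 (Nat.log 2 n) := ⟨_, rfl⟩
  have hn0 : n ≠ 0 := by
    have : 0 < 2 ^ (2 ^ 16) := by positivity
    exact (lt_of_lt_of_le this hn).ne'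
  have hp16 : 2 ^ 16 ≤ Nat.log 2 n := Nat.le_log_of_pow_le (by norm_num) hn
  clear hn
  have hq16 : 16 ≤ q := by rw [hq]; exact Nat.le_log_of_pow_le (by norm_num) hp16
  have hpq : 2 ^ q ≤ Nat.log 2 n := by
    rw [hq]; exact Nat.pow_log_le_self 2 (by omega)
  have hnq : 2 ^ (2 ^ q) ≤ n :=
    le_trans (Nat.pow_le_pow_right (by norm_num) hpq) (Nat.pow_log_le_self 2 hn0)
  obtain ⟨K, hK⟩ : ∃ K, q = K + 11 := ⟨q - 11, by omega⟩
  obtain ⟨A, hA⟩ : ∃ A, A = 2 ^ dd K := ⟨_, rfl⟩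
  have hA16 : 2 ^ 16 ≤ A := by rw [hA]; exact Nat.pow_le_pow_right (by norm_num) (sixteen_le_dd K)
  have hAn : A ^ 100 ≤ n := by
    refine le_trans ?_ hnq
    rw [hA, ← pow_mul]
    apply Nat.pow_le_pow_right (by norm_num)
    rw [hK, pow_add]
    have : dd K = 16 * 2 ^ K := rfl
    omega
  have hM : (Hset K).card ≤ A ^ 5 := by rw [hA]; exact Hset_card_le K
  have hA5 : A ^ 5 ≤ A ^ 90 := Nat.pow_le_pow_right (by omega) (by norm_num)
  have hA91 : A ^ 90 * 100 ≤ A ^ 100 := by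
    rw [show A ^ 100 = A ^ 90 * A ^ 10 by rw [← pow_add]]
    apply Nat.mul_le_mul_left
    have : A ≤ A ^ 10 := Nat.le_self_pow (by norm_num) A
    omega
  obtain ⟨N, hN⟩ : ∃ N, (Hset K).card + N = n := ⟨n - (Hset K).card, by omega⟩
  have hN90 : A ^ 90 ≤ N := by omega
  have hA1 : A ≤ A ^ 90 := Nat.le_self_pow (by norm_num) A
  have hdA : dd K ≤ A := by rw [hA]; exact Nat.lt_two_pow_self.le
  obtain ⟨lab, hlab⟩ := exists_lab K N n hN
  have : Nonempty (Fin n) := ⟨⟨0, by omega⟩⟩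
  have hup := upper_SS hlab (by rw [← hA]; exact hN90)
  have hlow := lower_SS hlab (by omega) (by omega) (by omega) (by rw [Fintype.card_fin]; omega)
    (⌊((SS True lab).card : ℝ) * K / 16⌋₊ + 1) (by
      push_cast
      have := Nat.floor_le (a := ((SS True lab).card : ℝ) * K / 16) (by positivity)
      linarith)
  have hsub := SS_ssub hlab (by omega)
  refine ⟨SS False lab, SS True lab, SS_isSwap _ _, SS_isSwap _ _,
    symmGen_SS hlab (by omega) _ (Or.inl rfl), symmGen_SS hlab (by omega) _ (Or.inr rfl), hsub,
    SS_cube hlab (by omega), ?_, ?_⟩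
  · have h1 := SS_card hlab
    have h2 : ((SS True lab).card : ℝ) ≤ (SS False lab).card + (A : ℝ) ^ 10 := by
      have : (SS True lab).card ≤ (SS False lab).card + A ^ 10 := by
        refine h1.trans ?_
        have : (Hset K).card ^ 2 ≤ (A ^ 5) ^ 2 := by gcongr
        have e : (A ^ 5) ^ 2 = A ^ 10 := by rw [← pow_mul]
        rw [e] at this
        omega
      exact_mod_cast this
    have h3 : (A : ℝ) ^ 10 ≤ Real.sqrt ((SS False lab).card : ℝ) := by
      apply Real.le_sqrt_of_sq_le
      have h4 := SS_card_ge hlab False 1 (by omega)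
      have h5 : A ^ 21 ≤ A ^ 90 := Nat.pow_le_pow_right (by omega) (by norm_num)
      have h6 : A ^ 20 * 2 ≤ A ^ 21 := by
        rw [pow_succ A 20]; apply Nat.mul_le_mul_left; omega
      have h7 : 0 < A ^ 20 := by
        have : 0 < A := by omega
        positivity
      have h8 : (A ^ 10) ^ 2 ≤ (SS False lab).card := by
        have e : (A ^ 10) ^ 2 = A ^ 20 := by rw [← pow_mul]
        rw [e]; omega
      exact_mod_cast h8
    linarith
  · have hL := logloglog_le n q (by
      have : 3 ≤ A := by omega
      omega) hq
    set L := Real.log (Real.log (Real.log (n.factorial : ℝ))) with hLdef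
    have hqK : (q : ℝ) + 2 ≤ 4 * K := by
      have : q + 2 ≤ 4 * K := by omega
      exact_mod_cast this
    have h1 : ((SS True lab).card : ℝ) * K / 16 ≤ tvMixUnif (lazyCayleyP (SS True lab)) := by
      have h2 := Nat.lt_floor_add_one (((SS True lab).card : ℝ) * K / 16)
      have h3 : ((⌊((SS True lab).card : ℝ) * K / 16⌋₊ : ℝ) + 1) ≤ tvMixUnif (lazyCayleyP (SS True lab)) := by
        exact_mod_cast hlow
      linarith
    have h2 : (tvMixUnif (lazyCayleyP (SS False lab)) : ℝ) ≤ 16 * (SS True lab).card := by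
      have h3 : tvMixUnif (lazyCayleyP (SS False lab)) ≤ 16 * (SS True lab).card :=
        hup.trans (Nat.mul_le_mul_left _ (Finset.card_le_card hsub.1))
      exact_mod_cast h3
    set m : ℝ := (tvMixUnif (lazyCayleyP (SS False lab)) : ℝ) with hm
    have hm0 : 0 ≤ m := by positivity
    have hK0 : (0 : ℝ) ≤ K := by positivity
    have h3 : m * L ≤ m * (4 * K) := by gcongr; linarith
    have h4 : m * K ≤ 16 * (SS True lab).card * K := by gcongr
    show _ ≥ _
    refine ge_trans h1 ?_
    show 1 / 1024 * m * L ≤ _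
    nlinarith
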